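/- arXiv:2012.08283 — 3 statements merged into one kernel-verified Lean document; each statement's English description precedes it below -/
import Mathlib

section
/- Let Z ⊆ ℕ be a piecewise syndetic set with bound B and let l_0 be a natural number. Then the set Z_0 := {l ∈ Z : (l + {l_0, l_0+1, …, l_0+B}) ∩ Z ≠ ∅} is piecewise syndetic. -/
noncomputable section

/-- `Z` is piecewise syndetic with bound `B`: for every `C ≥ 2` it contains `C` elements
`l_1 < ⋯ < l_C` with consecutive gaps at most `B`. -/
def PWSyndeticWith (Z : Set ℕ) (B : ℕ) : Prop :=
  ∀ C : ℕ, 2 ≤ C → ∃ l : ℕ → ℕ,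
    (∀ i, i < C → l i ∈ Z) ∧
    ∀ i, i + 1 < C → l i < l (i + 1) ∧ l (i + 1) - l i ≤ B

/-- `Z ⊆ ℕ` is piecewise syndetic. -/
def PWSyndetic (Z : Set ℕ) : Prop := ∃ B : ℕ, 1 ≤ B ∧ PWSyndeticWith Z B

/-- `Z ⊆ ℕ` is negligible if it is not piecewise syndetic. -/
def Negligible (Z : Set ℕ) : Prop := ¬ PWSyndetic Z

/-- `Z ⊆ ℕ` is full if its complement is negligible. -/
def FullSet (Z : Set ℕ) : Prop := Negligible Zᶜ

/-- A sequence increasing by steps of length at most `B` meets every window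
`[l i + d, l i + d + B]`. -/
theorem exists_index_mem_window {l : ℕ → ℕ} {B N : ℕ}
    (hl : ∀ i, i + 1 < N → l i < l (i + 1) ∧ l (i + 1) - l i ≤ B) (i d : ℕ) (hN : i + d < N) :
    ∃ k ≤ i + d, l i + d ≤ l k ∧ l k ≤ l i + d + B := by
  induction d with
  | zero => exact ⟨i, by omega, by omega, by omega⟩
  | succ d ih =>
    obtain ⟨k, hk, hlow, hupp⟩ := ih (by omega)
    by_cases h : l i + (d + 1) ≤ l k
    · exact ⟨k, by omega, h, by omega⟩
    · have := hl k (by omega)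
      exact ⟨k + 1, by omega, by omega, by omega⟩

/-- **Adamczewski–Faverjon, Lemma 5.2 (iii).**
If `Z` is piecewise syndetic with bound `B` and `l₀` is a natural number, then the set of
`l ∈ Z` such that `(l + {l₀, …, l₀ + B}) ∩ Z ≠ ∅` is piecewise syndetic. -/
theorem pwSyndetic_shift_intersect
    (Z : Set ℕ) (B : ℕ) (hB : 1 ≤ B) (hZ : PWSyndeticWith Z B) (l0 : ℕ) :
    PWSyndetic {l | l ∈ Z ∧ ∃ j : ℕ, l0 ≤ j ∧ j ≤ l0 + B ∧ l + j ∈ Z} := by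
  refine ⟨B, hB, fun C hC => ?_⟩
  obtain ⟨l, hmem, hgap⟩ := hZ (C + l0) (by omega)
  refine ⟨l, fun i hi => ⟨hmem i (by omega), ?_⟩, fun i hi => hgap i (by omega)⟩
  obtain ⟨k, hk, hlow, hupp⟩ := exists_index_mem_window hgap i l0 (by omega)
  refine ⟨l k - l i, by omega, by omega, ?_⟩
  rw [Nat.add_sub_cancel' (by omega)]
  exact hmem k (by omega)
end
end

section
/- Let ρ_1,…,ρ_r > 1 be real numbers and set Θ = (1/log ρ_1,…,1/log ρ_r) ∈ ℝ^r. Let V := {μ ∈ ℤ^r : ⟨μ,Θ⟩ = 0}, V^⊥ := {k ∈ ℤ^r : ⟨k,μ⟩ = 0 for all μ ∈ V}, and V_+^⊥ := V^⊥ ∩ ℕ^r. Then there exists a sequence (k_l)_{l∈ℕ} of elements of V_+^⊥ such that ‖k_l − lΘ‖ = O(1) as l → ∞ and k_l ≼ k_{l+1} for all l ∈ ℕ, where ≼ is the partial order on ℤ^r defined by k ≼ k' when every coordinate of k' − k is nonnegative. -/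
noncomputable section

/-- A finite family of real numbers has integer coordinates with respect to finitely many real
numbers, and these coordinates satisfy every integer linear relation of the family. -/
theorem exists_integer_coordinates {ι : Type*} [Fintype ι] (θ : ι → ℝ) :
    ∃ (m : ℕ) (b : Fin m → ℝ) (a : ι → Fin m → ℤ),
      (∀ i, θ i = ∑ j, (a i j : ℝ) * b j) ∧
      ∀ μ : ι → ℤ, ∑ i, (μ i : ℝ) * θ i = 0 → ∀ j, ∑ i, μ i * a i j = 0 := by
  let M : Submodule ℤ ℝ := Submodule.span ℤ (Set.range θ)
  have : Module.Finite ℤ M := Module.Finite.span_of_finite ℤ (Set.finite_range θ)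
  have : Module.Free ℤ M := Module.free_of_finite_type_torsion_free'
  let B := Module.finBasis ℤ M
  let t : ι → M := fun i => ⟨θ i, Submodule.subset_span ⟨i, rfl⟩⟩
  refine ⟨_, fun j => (B j : ℝ), fun i j => B.repr (t i) j, fun i => ?_, fun μ hμ j => ?_⟩
  · calc θ i = M.subtype (∑ j, B.repr (t i) j • B j) := by rw [B.sum_repr]; rfl
      _ = _ := by simp only [map_sum, map_zsmul, zsmul_eq_mul, Submodule.subtype_apply]
  · have h : ∑ i, μ i • t i = 0 := by
      apply Subtype.ext
      simpa [t] using hμ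
    have h' := congrArg (fun x => B.repr x j) h
    simpa [Finsupp.finsetSum_apply] using h'

/-- Rounding down the coefficients of an integer combination changes it by a bounded amount. -/
theorem abs_sum_floor_mul_sub_le {ι : Type*} [Fintype ι] (a : ι → ℤ) (b : ι → ℝ) (x : ℝ) :
    |((∑ j, ⌊x * b j⌋ * a j : ℤ) : ℝ) - x * ∑ j, (a j : ℝ) * b j| ≤ ∑ j, |(a j : ℝ)| := by
  push_cast
  rw [Finset.mul_sum, ← Finset.sum_sub_distrib]
  refine (Finset.abs_sum_le_sum_abs _ _).trans (Finset.sum_le_sum fun j _ => ?_)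
  have h : (⌊x * b j⌋ : ℝ) * a j - x * (a j * b j) = -(Int.fract (x * b j) * a j) := by
    rw [Int.fract]; ring
  rw [h, abs_neg, abs_mul, abs_of_nonneg (Int.fract_nonneg _)]
  exact mul_le_of_le_one_left (abs_nonneg _) (Int.fract_lt_one _).le

/-- **Adamczewski–Faverjon, Lemma 5.8.**
Let `ρ_1, …, ρ_r > 1` and `Θ = (1/log ρ_1, …, 1/log ρ_r)`.  Let `V` be the set of integer
vectors orthogonal to `Θ`, `V^⊥` its orthogonal complement in `ℤ^r`, and `V_+^⊥ = V^⊥ ∩ ℕ^r`.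
Then there is a sequence `(k_l)` in `V_+^⊥` with `‖k_l - l Θ‖ = O(1)` and `k_l ≼ k_{l+1}`
coordinatewise. -/
theorem exists_monotone_iteration_sequence
    (r : ℕ) (ρ : Fin r → ℝ) (hρ : ∀ i, 1 < ρ i) :
    ∃ k : ℕ → Fin r → ℤ,
      -- each `k_l` lies in `V_+^⊥`
      (∀ l : ℕ,
        ((∀ μ : Fin r → ℤ,
            (∑ i, (μ i : ℝ) * (Real.log (ρ i))⁻¹) = 0 →
            (∑ i, k l i * μ i) = 0) ∧
          ∀ i, 0 ≤ k l i)) ∧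
      -- `‖k_l - l Θ‖ = O(1)`
      (∃ C : ℝ, ∀ (l : ℕ) (i : Fin r),
        |(k l i : ℝ) - (l : ℝ) * (Real.log (ρ i))⁻¹| ≤ C) ∧
      -- `k_l ≼ k_{l+1}`
      (∀ (l : ℕ) (i : Fin r), k l i ≤ k (l + 1) i) := by
  set θ : Fin r → ℝ := fun i => (Real.log (ρ i))⁻¹
  have hpos : ∀ i, 0 < θ i := fun i => inv_pos.2 (Real.log_pos (hρ i))
  obtain ⟨m, b, a, hab, hrel⟩ := exists_integer_coordinates θ
  let A : Fin r → ℝ := fun i => ∑ j, |(a i j : ℝ)|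
  have hA : ∀ i, 0 ≤ A i := fun i => Finset.sum_nonneg fun j _ => abs_nonneg _
  -- A step `L` so large that `L * θ i` exceeds twice the rounding error.
  obtain ⟨L, hL0, hL⟩ : ∃ L : ℕ, 0 < L ∧ ∀ i, 2 * A i ≤ L * θ i := by
    obtain ⟨L, hL⟩ := exists_nat_gt (∑ i, 2 * A i / θ i)
    have hnn : ∀ i, 0 ≤ 2 * A i / θ i := fun i => div_nonneg (by linarith [hA i]) (hpos i).le
    refine ⟨L, ?_, fun i => ?_⟩
    · exact_mod_cast (Finset.sum_nonneg fun i _ => hnn i).trans_lt hL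
    · rw [← div_le_iff₀ (hpos i)]
      exact (Finset.single_le_sum (fun i _ => hnn i) (Finset.mem_univ i)).trans hL.le
  let κ : ℕ → Fin r → ℤ := fun q i => ∑ j, ⌊((q : ℝ) * L) * b j⌋ * a i j
  have hκ : ∀ q i, |(κ q i : ℝ) - q * L * θ i| ≤ A i := fun q i => by
    rw [hab i]
    exact abs_sum_floor_mul_sub_le (a i) b (q * L)
  have hmono : ∀ i, Monotone fun q => κ q i := fun i => monotone_nat_of_le_succ fun q => by
    have h₁ := abs_le.1 (hκ q i)
    have h₂ := abs_le.1 (hκ (q + 1) i)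
    have h₃ := hL i
    push_cast at h₂
    have : (κ q i : ℝ) ≤ κ (q + 1) i := by linarith [h₁.2, h₂.1]
    exact_mod_cast this
  refine ⟨fun l => κ (l / L), fun l => ⟨fun μ hμ => ?_, fun i => ?_⟩, ?_, fun l i => ?_⟩
  · simp only [κ, Finset.sum_mul]
    rw [Finset.sum_comm]
    refine Finset.sum_eq_zero fun j _ => ?_
    rw [← mul_zero ⌊((l / L : ℕ) : ℝ) * L * b j⌋, ← hrel μ hμ j, Finset.mul_sum]
    exact Finset.sum_congr rfl fun i _ => by ring
  · simpa [κ] using hmono i (Nat.zero_le (l / L))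
  · refine ⟨∑ i, (A i + L * θ i), fun l i => ?_⟩
    have hi : A i + L * θ i ≤ ∑ i, (A i + L * θ i) :=
      Finset.single_le_sum (f := fun i => A i + L * θ i)
        (fun i _ => add_nonneg (hA i) (mul_nonneg L.cast_nonneg (hpos i).le)) (Finset.mem_univ i)
    refine le_trans ?_ hi
    have hl : (l : ℝ) = (l / L : ℕ) * L + (l % L : ℕ) := by
      exact_mod_cast (Nat.div_add_mod' l L).symm
    have hmod : ((l % L : ℕ) : ℝ) ≤ L := by exact_mod_cast (Nat.mod_lt l hL0).le
    have h₁ := abs_le.1 (hκ (l / L) i)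
    have h₂ := mul_le_mul_of_nonneg_right hmod (hpos i).le
    have h₃ : 0 ≤ ((l % L : ℕ) : ℝ) * θ i := mul_nonneg (Nat.cast_nonneg _) (hpos i).le
    change |(κ (l / L) i : ℝ) - l * θ i| ≤ _
    rw [hl, add_mul, abs_le]
    constructor <;> linarith [h₁.1, h₁.2]
  · exact hmono i (Nat.div_le_div_right l.le_succ)
end
end

section
/- Let r ≥ 1 be an integer, let b_1,…,b_r be multiplicatively independent integers ≥ 2, and for every i with 1 ≤ i ≤ r let ξ_i be a real number that is automatic in base b_i. Then the numbers ξ_1,…,ξ_r are algebraically independent over ℚ̄, unless one of them is rational. (In particular, an irrational real number cannot be automatic in two multiplicatively independent integer bases.) -/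
open scoped BigOperators

noncomputable section

/-- A sequence `a : ℕ → ℕ` is `k`-automatic: its `k`-kernel, the set of sequences
`n ↦ a (k^e n + j)` for `e ≥ 0` and `0 ≤ j < k^e`, is finite. -/
def IsKAutomatic (k : ℕ) (a : ℕ → ℕ) : Prop :=
  {g : ℕ → ℕ | ∃ e j : ℕ, j < k ^ e ∧ g = fun n => a (k ^ e * n + j)}.Finite

/-- A real number `ξ` is automatic in base `b`: there are an integer `k ≥ 2` and a
`k`-automatic sequence `(a_n)` with values in `{0, …, b-1}` such that the fractional part of
`ξ` is `∑_{n ≥ 1} a_n b^{-n}`. -/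
def AutomaticInBase (b : ℕ) (ξ : ℝ) : Prop :=
  ∃ k : ℕ, 2 ≤ k ∧ ∃ a : ℕ → ℕ, (∀ n, a n < b) ∧ IsKAutomatic k a ∧
    Int.fract ξ = ∑' n : ℕ, (a (n + 1) : ℝ) / (b : ℝ) ^ (n + 1)

section FiniteValued

open Polynomial

/-- The Euler derivation `X * d/dX` on formal power series. -/
def eulerDerivation : Derivation ℚ (PowerSeries ℚ) (PowerSeries ℚ) :=
  (PowerSeries.X : PowerSeries ℚ) • PowerSeries.derivative ℚ

theorem coeff_eulerDerivation (y : PowerSeries ℚ) (n : ℕ) :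
    PowerSeries.coeff n (eulerDerivation y) = n * PowerSeries.coeff n y := by
  cases n with
  | zero => simp [eulerDerivation]
  | succ n =>
    simp [eulerDerivation, PowerSeries.coeff_succ_X_mul, PowerSeries.coeff_derivative, mul_comm]

theorem coeff_iterate_eulerDerivation (y : PowerSeries ℚ) (j n : ℕ) :
    PowerSeries.coeff n (eulerDerivation^[j] y) = (n : ℚ) ^ j * PowerSeries.coeff n y := by
  induction j with
  | zero => simp
  | succ j ih =>
    rw [Function.iterate_succ_apply', coeff_eulerDerivation, ih]; ring

theorem algebraMap_powerSeries_injective :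
    Function.Injective (algebraMap ℚ[X] (PowerSeries ℚ)) :=
  Polynomial.coe_injective ℚ

theorem exists_eulerDerivation_aeval (x : PowerSeries ℚ) (P : ℚ[X][X]) :
    ∃ Q : ℚ[X][X], eulerDerivation (aeval x P) =
      aeval x Q + aeval x (derivative P) * eulerDerivation x := by
  induction P using Polynomial.induction_on' with
  | add p q hp hq =>
    obtain ⟨P, hP⟩ := hp
    obtain ⟨Q, hQ⟩ := hq
    exact ⟨P + Q, by rw [map_add, map_add, hP, hQ, map_add, map_add, map_add]; ring⟩
  | monomial n a =>
    refine ⟨monomial n (X * derivative a), ?_⟩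
    have h1 : eulerDerivation (algebraMap ℚ[X] (PowerSeries ℚ) a) =
        algebraMap ℚ[X] (PowerSeries ℚ) (X * derivative a) := by
      ext k
      rw [coeff_eulerDerivation]
      have h : ∀ p : ℚ[X], algebraMap ℚ[X] (PowerSeries ℚ) p = (p : PowerSeries ℚ) := fun p => rfl
      rw [h, h, coeff_coe, coeff_coe]
      cases k with
      | zero => simp
      | succ k => rw [coeff_X_mul, coeff_derivative]; push_cast; ring
    rw [aeval_monomial, aeval_monomial, derivative_monomial, aeval_monomial, Derivation.leibniz,
      Derivation.leibniz_pow, h1]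
    simp only [smul_eq_mul, nsmul_eq_mul, map_mul, map_natCast]
    ring

theorem exists_mul_eulerDerivation_eq {x : PowerSeries ℚ} (hx : IsAlgebraic ℚ[X] x) :
    ∃ u v : ℚ[X][X], aeval x u ≠ 0 ∧ aeval x u * eulerDerivation x = aeval x v := by
  classical
  have hex : ∃ n : ℕ, ∃ P : ℚ[X][X], P ≠ 0 ∧ aeval x P = 0 ∧ P.natDegree = n := by
    obtain ⟨P, h0, h1⟩ := hx
    exact ⟨_, P, h0, h1, rfl⟩
  obtain ⟨P, hP0, hPx, hPn⟩ := Nat.find_spec hex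
  have hdeg : P.natDegree ≠ 0 := by
    intro h
    rw [natDegree_eq_zero] at h
    obtain ⟨a, rfl⟩ := h
    rw [aeval_C] at hPx
    have := algebraMap_powerSeries_injective (hPx.trans (map_zero _).symm)
    exact hP0 (by rw [this, C_0])
  have hder : aeval x (derivative P) ≠ 0 := by
    intro h
    refine Nat.find_min hex (m := (derivative P).natDegree) ?_ ⟨_, ?_, h, rfl⟩
    · rw [← hPn]; exact natDegree_derivative_lt hdeg
    · intro h0
      exact hdeg (derivative_eq_zero.1 h0)
  obtain ⟨Q, hQ⟩ := exists_eulerDerivation_aeval x P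
  refine ⟨derivative P, -Q, hder, ?_⟩
  rw [hPx, map_zero] at hQ
  rw [map_neg]
  linear_combination -hQ

theorem exists_sum_iterate_eulerDerivation_eq_zero {y : PowerSeries ℚ} (hy : IsAlgebraic ℚ[X] y) :
    ∃ d : ℕ, ∃ q : Fin d → ℚ[X], q ≠ 0 ∧
      ∑ j, (q j : PowerSeries ℚ) * eulerDerivation^[j] y = 0 := by
  let K := FractionRing ℚ[X]
  let L := FractionRing (PowerSeries ℚ)
  have : FaithfulSMul ℚ[X] L := by
    rw [faithfulSMul_iff_algebraMap_injective, IsScalarTower.algebraMap_eq ℚ[X] (PowerSeries ℚ) L]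
    exact (IsFractionRing.injective (PowerSeries ℚ) L).comp
      algebraMap_powerSeries_injective
  let _ : Algebra K L := FractionRing.liftAlgebra ℚ[X] L
  have : IsScalarTower ℚ[X] K L := FractionRing.isScalarTower_liftAlgebra ℚ[X] L
  let e := algebraMap (PowerSeries ℚ) L
  have he : Function.Injective e := IsFractionRing.injective (PowerSeries ℚ) L
  have hyK : IsAlgebraic K (e y) :=
    (IsFractionRing.isAlgebraic_iff ℚ[X] K L).1 (hy.algebraMap)
  let M := IntermediateField.adjoin K {e y}
  have hfd : FiniteDimensional K M := IntermediateField.adjoin.finiteDimensional hyK.isIntegral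
  have hmem : ∀ (P : ℚ[X][X]) (x : PowerSeries ℚ), e x ∈ M → e (aeval x P) ∈ M := by
    intro P x hx
    have : e (aeval x P) = aeval (e x) (P.map (algebraMap ℚ[X] K)) := by
      rw [aeval_map_algebraMap, aeval_algebraMap_apply]
    rw [this]
    exact Algebra.adjoin_le (S := M.toSubalgebra) (Set.singleton_subset_iff.2 hx)
      (aeval_mem_adjoin_singleton K (e x))
  have hstep : ∀ x : PowerSeries ℚ, e x ∈ M → e (eulerDerivation x) ∈ M := by
    intro x hx
    have hxa : IsAlgebraic ℚ[X] x := by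
      rw [← isAlgebraic_algebraMap_iff he]
      refine (IsFractionRing.isAlgebraic_iff ℚ[X] K L).2 ?_
      have := (Algebra.IsAlgebraic.of_finite K M).isAlgebraic ⟨e x, hx⟩
      exact (isAlgebraic_algebraMap_iff (A := L) (algebraMap M L).injective).2 this
    obtain ⟨u, v, hu, huv⟩ := exists_mul_eulerDerivation_eq hxa
    have h0 : e (aeval x u) ≠ 0 := fun h => hu (he (h.trans (map_zero e).symm))
    have : e (eulerDerivation x) = e (aeval x v) / e (aeval x u) := by
      rw [eq_div_iff h0, ← map_mul, ← huv, mul_comm]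
    rw [this]
    exact M.div_mem (hmem _ _ hx) (hmem _ _ hx)
  have hiter : ∀ j : ℕ, e (eulerDerivation^[j] y) ∈ M := by
    intro j
    induction j with
    | zero => exact IntermediateField.mem_adjoin_simple_self K (e y)
    | succ j ih => rw [Function.iterate_succ_apply']; exact hstep _ ih
  let d := Module.finrank K M + 1
  have hdep : ¬ LinearIndependent ℚ[X] (fun j : Fin d => e (eulerDerivation^[(j : ℕ)] y)) := by
    rw [LinearIndependent.iff_fractionRing ℚ[X] K]
    intro h
    have h2 : LinearIndependent K
        (fun j : Fin d => (⟨e (eulerDerivation^[(j : ℕ)] y), hiter j⟩ : M)) :=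
      LinearIndependent.of_comp M.val.toLinearMap h
    have := h2.fintype_card_le_finrank
    simp [d] at this
  rw [Fintype.not_linearIndependent_iff] at hdep
  obtain ⟨g, hg, i, hi⟩ := hdep
  refine ⟨d, g, fun h => hi (congrFun h i), he ?_⟩
  rw [map_sum, map_zero, ← hg]
  refine Finset.sum_congr rfl fun j _ => ?_
  rw [Algebra.smul_def, map_mul]
  rfl

/-- A power series with finitely many distinct coefficients which is algebraic over `ℚ(X)` is a
rational function. -/
theorem exists_mul_eq_coe_of_isAlgebraic_of_finite_range {y : PowerSeries ℚ}
    (hy : IsAlgebraic ℚ[X] y) (hfin : (Set.range fun n => PowerSeries.coeff n y).Finite) :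
    ∃ s p : ℚ[X], s ≠ 0 ∧ (s : PowerSeries ℚ) * y = p := by
  classical
  obtain ⟨d, q, hq0, hq⟩ := exists_sum_iterate_eulerDerivation_eq_zero hy
  obtain ⟨I, hI⟩ : ∃ I : ℕ, ∀ j, (q j).natDegree < I :=
    ⟨(Finset.univ.sup fun j => (q j).natDegree) + 1, fun j =>
      Nat.lt_succ_of_le (Finset.le_sup (f := fun j => (q j).natDegree) (Finset.mem_univ j))⟩
  let r : ℕ → ℚ[X] := fun i => ∑ j, C ((q j).coeff i) * X ^ (j : ℕ)
  let R : (Fin I → ℚ) → ℚ[X] := fun v => ∑ i, C (v i) * (r i).comp (X - C ((i : ℕ) : ℚ))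
  let w : ℕ → Fin I → ℚ := fun n i => PowerSeries.coeff (n - i) y
  have hcoeff : ∀ (p : ℚ[X]) (x : PowerSeries ℚ) (n : ℕ), p.natDegree < I → I ≤ n →
      PowerSeries.coeff n ((p : PowerSeries ℚ) * x) =
        ∑ i : Fin I, p.coeff i * PowerSeries.coeff (n - i) x := by
    intro p x n hp hn
    rw [PowerSeries.coeff_mul, Finset.Nat.sum_antidiagonal_eq_sum_range_succ
      (fun i j => PowerSeries.coeff i (p : PowerSeries ℚ) * PowerSeries.coeff j x),
      Fin.sum_univ_eq_sum_range (fun i => p.coeff i * PowerSeries.coeff (n - i) x) I]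
    symm
    have hsub : Finset.range I ⊆ Finset.range n.succ := by
      intro a; simp only [Finset.mem_range]; omega
    simp only [coeff_coe]
    refine Finset.sum_subset hsub fun i _ hi => ?_
    rw [Finset.mem_range, not_lt] at hi
    rw [coeff_eq_zero_of_natDegree_lt (by omega), zero_mul]
  have hR : ∀ n, I ≤ n → (R (w n)).eval (n : ℚ) = 0 := by
    intro n hn
    have h := congrArg (PowerSeries.coeff n) hq
    rw [map_sum, map_zero] at h
    rw [← h]
    simp only [hcoeff _ _ n (hI _) hn, coeff_iterate_eulerDerivation]
    rw [Finset.sum_comm]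
    simp only [R, r, w, eval_finsetSum, eval_mul, eval_C, eval_comp, eval_sub, eval_X, eval_pow]
    refine Finset.sum_congr rfl fun i _ => ?_
    rw [Finset.mul_sum]
    refine Finset.sum_congr rfl fun j _ => ?_
    rw [Nat.cast_sub (by omega)]
    ring
  have hwfin : (Set.range w).Finite := by
    refine Set.Finite.subset (Set.Finite.pi' (ι := Fin I) fun _ => hfin) ?_
    rintro _ ⟨n, rfl⟩ i
    exact ⟨_, rfl⟩
  obtain ⟨N, hN⟩ : ∃ N : ℕ, ∀ v ∈ Set.range w, R v ≠ 0 → ∀ n : ℕ, N ≤ n →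
      (R v).eval (n : ℚ) ≠ 0 := by
    have hfin2 : (⋃ v ∈ Set.range w, {n : ℕ | R v ≠ 0 ∧ (R v).eval (n : ℚ) = 0}).Finite := by
      refine hwfin.biUnion fun v _ => ?_
      by_cases h : R v = 0
      · simp [h]
      · refine Set.Finite.subset (((R v).roots.toFinset.finite_toSet).preimage
          (Nat.cast_injective (R := ℚ)).injOn) ?_
        rintro n ⟨h1, h2⟩
        simp [h, h2]
    obtain ⟨N, hN⟩ := hfin2.bddAbove
    refine ⟨N + 1, fun v hv h n hn h0 => ?_⟩
    have := hN (Set.mem_biUnion hv ⟨h, h0⟩)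
    omega
  have hRz : ∀ n, max I N ≤ n → R (w n) = 0 := by
    intro n hn
    by_contra h
    exact hN _ ⟨n, rfl⟩ h n (le_trans (le_max_right _ _) hn) (hR n (le_trans (le_max_left _ _) hn))
  obtain ⟨j0, hj0⟩ : ∃ j, q j ≠ 0 := by
    by_contra h
    push Not at h
    exact hq0 (funext h)
  let i0 := (q j0).natDegree
  have hri0 : r i0 ≠ 0 := by
    intro h
    have h2 : (r i0).coeff j0 = (q j0).coeff i0 := by
      simp only [r, finsetSum_coeff, coeff_C_mul_X_pow]
      rw [Finset.sum_eq_single j0]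
      · simp
      · intro b _ hb
        rw [if_neg]
        intro h
        exact hb (Fin.ext h.symm)
      · simp
    rw [h, coeff_zero] at h2
    exact hj0 (leadingCoeff_eq_zero.1 h2.symm)
  obtain ⟨t, ht⟩ : ∃ t : ℚ, (r i0).eval (t - i0) ≠ 0 := by
    by_contra h
    push Not at h
    refine hri0 (funext fun x => ?_)
    have := h (x + i0)
    simpa using this
  let s : ℚ[X] := ∑ i : Fin I, C ((r i).eval (t - i)) * X ^ (i : ℕ)
  have hsc : ∀ i : Fin I, s.coeff i = (r i).eval (t - i) := by
    intro i
    simp only [s, finsetSum_coeff, coeff_C_mul_X_pow]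
    rw [Finset.sum_eq_single i]
    · simp
    · intro b _ hb
      rw [if_neg]
      intro h
      exact hb (Fin.ext h.symm)
    · simp
  have hsdeg : s.natDegree < I := by
    have hIpos : 0 < I := lt_of_le_of_lt (Nat.zero_le _) (hI j0)
    refine lt_of_le_of_lt (natDegree_sum_le_of_forall_le (n := I - 1) _ _ fun i _ => ?_) (by omega)
    refine (natDegree_C_mul_X_pow_le _ _).trans ?_
    have := i.2
    omega
  refine ⟨s, PowerSeries.trunc (max I N) ((s : PowerSeries ℚ) * y), ?_, ?_⟩
  · intro h
    have := hsc ⟨i0, hI j0⟩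
    rw [h, coeff_zero] at this
    exact ht this.symm
  · ext n
    rw [coeff_coe, PowerSeries.coeff_trunc]
    split_ifs with h
    · rfl
    · rw [not_lt] at h
      rw [hcoeff _ _ n hsdeg (le_trans (le_max_left _ _) h)]
      have := congrArg (eval t) (hRz n h)
      simp only [R, eval_finsetSum, eval_mul, eval_C, eval_comp, eval_sub, eval_X, eval_zero]
        at this
      rw [← this]
      refine Finset.sum_congr rfl fun i _ => ?_
      rw [hsc, mul_comm]

end FiniteValued

section ConvergentSeries

open Filter Topology

variable {σ : Type*} [Fintype σ]

/-- The value of the monomial with exponent `μ` at the point `z`. -/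
def monomialValue {R : Type*} [CommMonoid R] (z : σ → R) (μ : σ →₀ ℕ) : R := ∏ i, z i ^ μ i

theorem monomialValue_zero {R : Type*} [CommMonoid R] (z : σ → R) : monomialValue z 0 = 1 := by
  simp [monomialValue]

theorem monomialValue_add {R : Type*} [CommMonoid R] (z : σ → R) (μ ν : σ →₀ ℕ) :
    monomialValue z (μ + ν) = monomialValue z μ * monomialValue z ν := by
  simp [monomialValue, pow_add, Finset.prod_mul_distrib]

theorem monomialValue_const {R : Type*} [CommMonoid R] (t : R) (μ : σ →₀ ℕ) :
    monomialValue (fun _ => t) μ = t ^ μ.degree := by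
  simp [monomialValue, Finsupp.degree_eq_sum, Finset.prod_pow_eq_pow_sum]

theorem monomialValue_nonneg {z : σ → ℝ} (hz : ∀ i, 0 ≤ z i) (μ : σ →₀ ℕ) :
    0 ≤ monomialValue z μ :=
  Finset.prod_nonneg fun i _ => pow_nonneg (hz i) _

theorem monomialValue_pos {z : σ → ℝ} (hz : ∀ i, 0 < z i) (μ : σ →₀ ℕ) :
    0 < monomialValue z μ :=
  Finset.prod_pos fun i _ => pow_pos (hz i) _

theorem monomialValue_mono {z w : σ → ℝ} (hz : ∀ i, 0 ≤ z i) (hzw : ∀ i, z i ≤ w i)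
    (μ : σ →₀ ℕ) : monomialValue z μ ≤ monomialValue w μ :=
  Finset.prod_le_prod (fun i _ => pow_nonneg (hz i) _)
    fun i _ => pow_le_pow_left₀ (hz i) (hzw i) _

/-- The weights defining the algebra of series converging on the polydisc of radius `1/2`. -/
def halfTerm (c : MvPowerSeries σ ℚ) (μ : σ →₀ ℕ) : ℝ :=
  |((MvPowerSeries.coeff μ c : ℚ) : ℝ)| * monomialValue (fun _ => (1 / 2 : ℝ)) μ

theorem halfTerm_nonneg (c : MvPowerSeries σ ℚ) (μ : σ →₀ ℕ) : 0 ≤ halfTerm c μ :=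
  mul_nonneg (abs_nonneg _) (monomialValue_nonneg (fun _ => by norm_num) μ)

theorem summable_halfTerm_mul {c d : MvPowerSeries σ ℚ} (hc : Summable (halfTerm c))
    (hd : Summable (halfTerm d)) : Summable (halfTerm (c * d)) := by
  classical
  have h := summable_sum_mul_antidiagonal_of_summable_mul
    (hc.mul_of_nonneg hd (halfTerm_nonneg c) (halfTerm_nonneg d))
  refine Summable.of_nonneg_of_le (halfTerm_nonneg _) (fun μ => ?_) h
  rw [halfTerm, MvPowerSeries.coeff_mul, Rat.cast_sum]
  refine (mul_le_mul_of_nonneg_right (Finset.abs_sum_le_sum_abs _ _)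
    (monomialValue_nonneg (fun _ => by norm_num) μ)).trans ?_
  rw [Finset.sum_mul]
  refine Finset.sum_le_sum fun p hp => le_of_eq ?_
  rw [Finset.HasAntidiagonal.mem_antidiagonal] at hp
  rw [halfTerm, halfTerm, ← hp, monomialValue_add, Rat.cast_mul, abs_mul]
  ring

/-- Power series with rational coefficients which converge absolutely on the closed polydisc of
radius `1/2`. -/
def convergentSeries (σ : Type*) [Fintype σ] : Subalgebra ℚ (MvPowerSeries σ ℚ) where
  carrier := {c | Summable (halfTerm c)}
  mul_mem' hc hd := summable_halfTerm_mul hc hd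
  add_mem' {c d} hc hd := by
    refine Summable.of_nonneg_of_le (halfTerm_nonneg _) (fun μ => ?_) (hc.add hd)
    simp only [halfTerm]
    rw [← add_mul, map_add, Rat.cast_add]
    exact mul_le_mul_of_nonneg_right (abs_add_le _ _)
      (monomialValue_nonneg (fun _ => by norm_num) μ)
  algebraMap_mem' q := by
    classical
    refine summable_of_hasFiniteSupport ((Set.finite_singleton (0 : σ →₀ ℕ)).subset fun μ hμ => ?_)
    by_contra h
    rw [Set.mem_singleton_iff] at h
    refine hμ ?_
    rw [halfTerm, MvPowerSeries.algebraMap_apply, MvPowerSeries.coeff_C, if_neg h]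
    simp

theorem mem_convergentSeries {c : MvPowerSeries σ ℚ} :
    c ∈ convergentSeries σ ↔ Summable (halfTerm c) := Iff.rfl

theorem mem_convergentSeries_of_finite {c : MvPowerSeries σ ℚ}
    (hc : {μ | MvPowerSeries.coeff μ c ≠ 0}.Finite) : c ∈ convergentSeries σ := by
  refine summable_of_hasFiniteSupport (hc.subset fun μ hμ => ?_)
  rw [Function.mem_support] at hμ
  intro h
  rw [halfTerm, h] at hμ
  simp at hμ

theorem X_mem_convergentSeries (i : σ) :
    (MvPowerSeries.X i : MvPowerSeries σ ℚ) ∈ convergentSeries σ := by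
  classical
  refine mem_convergentSeries_of_finite
    ((Set.finite_singleton (Finsupp.single i 1)).subset fun μ hμ => ?_)
  by_contra h
  rw [Set.mem_singleton_iff] at h
  refine hμ ?_
  rw [MvPowerSeries.coeff_X, if_neg h]

/-- The terms of a power series at the point `z`. -/
def seriesTerm (z : σ → ℝ) (c : MvPowerSeries σ ℚ) (μ : σ →₀ ℕ) : ℝ :=
  ((MvPowerSeries.coeff μ c : ℚ) : ℝ) * monomialValue z μ

theorem norm_seriesTerm_le {z : σ → ℝ} (hz : ∀ i, 0 ≤ z i) (hz' : ∀ i, z i ≤ 1 / 2)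
    (c : MvPowerSeries σ ℚ) (μ : σ →₀ ℕ) : ‖seriesTerm z c μ‖ ≤ halfTerm c μ := by
  rw [Real.norm_eq_abs, seriesTerm, halfTerm, abs_mul, abs_of_nonneg (monomialValue_nonneg hz μ)]
  exact mul_le_mul_of_nonneg_left (monomialValue_mono hz hz' μ) (abs_nonneg _)

theorem summable_norm_seriesTerm {z : σ → ℝ} (hz : ∀ i, 0 ≤ z i) (hz' : ∀ i, z i ≤ 1 / 2)
    {c : MvPowerSeries σ ℚ} (hc : c ∈ convergentSeries σ) :
    Summable fun μ => ‖seriesTerm z c μ‖ :=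
  Summable.of_nonneg_of_le (fun _ => norm_nonneg _) (norm_seriesTerm_le hz hz' c) hc

/-- Evaluation of a convergent power series at a point of the polydisc of radius `1/2`. -/
def evalSeries (z : σ → ℝ) (hz : ∀ i, 0 ≤ z i) (hz' : ∀ i, z i ≤ 1 / 2) :
    convergentSeries σ →+* ℝ where
  toFun c := ∑' μ, seriesTerm z c μ
  map_one' := by
    classical
    rw [tsum_eq_single 0]
    · simp [seriesTerm, monomialValue_zero]
    · intro μ hμ
      simp [seriesTerm, MvPowerSeries.coeff_one, hμ]
  map_zero' := by simp [seriesTerm]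
  map_add' c d := by
    rw [← (summable_norm_seriesTerm hz hz' c.2).of_norm.tsum_add
      (summable_norm_seriesTerm hz hz' d.2).of_norm]
    refine tsum_congr fun μ => ?_
    simp only [seriesTerm, Subalgebra.coe_add, map_add, Rat.cast_add]
    ring
  map_mul' c d := by
    classical
    have hc := summable_norm_seriesTerm hz hz' c.2
    have hd := summable_norm_seriesTerm hz hz' d.2
    rw [hc.of_norm.tsum_mul_tsum_eq_tsum_sum_antidiagonal hd.of_norm
      (summable_mul_of_summable_norm hc hd)]
    refine tsum_congr fun μ => ?_
    rw [seriesTerm, Subalgebra.coe_mul, MvPowerSeries.coeff_mul, Rat.cast_sum, Finset.sum_mul]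
    refine Finset.sum_congr rfl fun p hp => ?_
    rw [Finset.HasAntidiagonal.mem_antidiagonal] at hp
    rw [seriesTerm, seriesTerm, ← hp, monomialValue_add, Rat.cast_mul]
    ring

theorem evalSeries_apply (z : σ → ℝ) (hz : ∀ i, 0 ≤ z i) (hz' : ∀ i, z i ≤ 1 / 2)
    (c : convergentSeries σ) : evalSeries z hz hz' c = ∑' μ, seriesTerm z c μ := rfl

theorem evalSeries_X (z : σ → ℝ) (hz : ∀ i, 0 ≤ z i) (hz' : ∀ i, z i ≤ 1 / 2) (i : σ) :
    evalSeries z hz hz' ⟨_, X_mem_convergentSeries i⟩ = z i := by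
  classical
  rw [evalSeries_apply, tsum_eq_single (Finsupp.single i 1)]
  · rw [seriesTerm, MvPowerSeries.coeff_X, if_pos rfl, monomialValue,
      Finset.prod_eq_single i]
    · simp
    · intro j _ hj
      simp [Ne.symm hj]
    · simp
  · intro μ hμ
    simp [seriesTerm, MvPowerSeries.coeff_X, hμ]

theorem abs_evalSeries_le (z : σ → ℝ) (hz : ∀ i, 0 ≤ z i) (hz' : ∀ i, z i ≤ 1 / 2) {t : ℝ}
    (ht0 : 0 ≤ t) (ht : t ≤ 1 / 2) (hzt : ∀ i, z i ≤ t) (c : convergentSeries σ) (N : ℕ)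
    (hN : ∀ μ : σ →₀ ℕ, μ.degree < N → MvPowerSeries.coeff μ c.1 = 0) :
    |evalSeries z hz hz' c| ≤ (2 * t) ^ N * ∑' μ, halfTerm c.1 μ := by
  rw [evalSeries_apply, ← tsum_mul_left]
  have hb : ∀ μ, ‖seriesTerm z c.1 μ‖ ≤ (2 * t) ^ N * halfTerm c.1 μ := by
    intro μ
    by_cases h : MvPowerSeries.coeff μ c.1 = 0
    · simp [seriesTerm, halfTerm, h]
    · have hdeg : N ≤ μ.degree := not_lt.1 fun h2 => h (hN μ h2)
      rw [Real.norm_eq_abs, seriesTerm, halfTerm, abs_mul,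
        abs_of_nonneg (monomialValue_nonneg hz μ), mul_left_comm]
      refine mul_le_mul_of_nonneg_left ?_ (abs_nonneg _)
      refine (monomialValue_mono hz hzt μ).trans ?_
      rw [monomialValue_const, monomialValue_const]
      calc t ^ μ.degree = (2 * t) ^ μ.degree * (1 / 2) ^ μ.degree := by
            rw [← mul_pow]; congr 1; ring
        _ ≤ (2 * t) ^ N * (1 / 2) ^ μ.degree := by
            refine mul_le_mul_of_nonneg_right ?_ (by positivity)
            exact pow_le_pow_of_le_one (by linarith) (by linarith) hdeg
  exact tsum_of_norm_bounded (Summable.hasSum (mem_convergentSeries.1 c.2 |>.mul_left _)) hb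

end ConvergentSeries

section EvaluationSetup

open Filter Topology

variable {σ : Type*} [Fintype σ]

/-- Monomials, as convergent power series. -/
def convergentMonomial (ν : σ →₀ ℕ) : convergentSeries σ :=
  monomialValue (fun i => ⟨_, X_mem_convergentSeries i⟩) ν

theorem coe_convergentMonomial (ν : σ →₀ ℕ) :
    (convergentMonomial ν : MvPowerSeries σ ℚ) = MvPowerSeries.monomial ν 1 := by
  have h := MvPowerSeries.monomial_one_eq (R := ℚ) ν
  rw [h, Finsupp.prod_fintype _ _ (by simp), convergentMonomial, monomialValue]
  simp

theorem coe_intCast_convergentSeries (n : ℤ) :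
    ((n : convergentSeries σ) : MvPowerSeries σ ℚ) = MvPowerSeries.C (n : ℚ) := by
  rw [map_intCast]; rfl

theorem coeff_sum_smul_convergentMonomial {α : Type*} [Fintype α] (e : α → σ →₀ ℕ)
    (he : Function.Injective e) (p : α → ℤ) (ν : α) :
    MvPowerSeries.coeff (e ν)
      ((∑ ν, (p ν : convergentSeries σ) * convergentMonomial (e ν) : convergentSeries σ) :
        MvPowerSeries σ ℚ) = p ν := by
  classical
  rw [AddSubmonoidClass.coe_finsetSum, map_sum, Finset.sum_eq_single ν]
  · rw [Subalgebra.coe_mul, coe_convergentMonomial, coe_intCast_convergentSeries,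
      MvPowerSeries.coeff_C_mul,
      MvPowerSeries.coeff_monomial_same, mul_one]
  · intro μ _ hμ
    rw [Subalgebra.coe_mul, coe_convergentMonomial, coe_intCast_convergentSeries,
      MvPowerSeries.coeff_C_mul,
      MvPowerSeries.coeff_monomial_ne (fun h => hμ (he h).symm), mul_zero]
  · simp

/-- Siegel-type lemma without height bounds: a homogeneous linear system with rational coefficients
and more unknowns than equations has a nonzero integral solution. -/
theorem exists_int_solution {α γ : Type*} [Fintype α] [Fintype γ] (A : γ → α → ℚ)
    (h : Fintype.card γ < Fintype.card α) :
    ∃ p : α → ℤ, p ≠ 0 ∧ ∀ c, ∑ x, (p x : ℚ) * A c x = 0 := by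
  classical
  let L : (α → ℚ) →ₗ[ℚ] (γ → ℚ) := Matrix.mulVecLin (Matrix.of A)
  have hL : LinearMap.ker L ≠ ⊥ := LinearMap.ker_ne_bot_of_finrank_lt (by simpa using h)
  obtain ⟨v, hv, hv0⟩ := Submodule.exists_mem_ne_zero_of_ne_bot hL
  obtain ⟨b, hb⟩ := IsLocalization.exist_integer_multiples_of_finset (nonZeroDivisors ℤ)
    (Finset.univ.image v)
  have hb0 : (b : ℤ) ≠ 0 := nonZeroDivisors.coe_ne_zero b
  choose p hp using fun x => hb (v x) (Finset.mem_image_of_mem v (Finset.mem_univ x))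
  have hp' : ∀ x, (p x : ℚ) = (b : ℤ) * v x := fun x => by
    have := hp x
    simpa using this
  refine ⟨p, fun h0 => hv0 (funext fun x => ?_), fun c => ?_⟩
  · have := hp' x
    rw [h0] at this
    simpa [hb0] using this.symm
  · have := congrFun (LinearMap.mem_ker.1 hv) c
    simp only [L, Matrix.mulVecLin_apply, Matrix.mulVec, dotProduct, Matrix.of_apply,
      Pi.zero_apply] at this
    simp only [hp', mul_assoc, ← Finset.mul_sum]
    rw [mul_eq_zero]
    right
    rw [← this]
    exact Finset.sum_congr rfl fun x _ => mul_comm _ _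

/-- Data for evaluating convergent power series at a point with infinitesimal coordinates `1 / B i`
of an ordered field having a discrete subring. -/
structure EvaluationSetup (σ : Type*) [Fintype σ] (E : Type*) [Field E] [LinearOrder E]
    [IsStrictOrderedRing E] where
  ints : Subring E
  one_le_abs : ∀ x ∈ ints, x ≠ 0 → 1 ≤ |x|
  β : E
  natCast_le : ∀ n : ℕ, (n : E) ≤ β
  κ : ℕ
  B : σ → E
  B_mem : ∀ i, B i ∈ ints
  le_B : ∀ i, β ≤ B i
  B_le : ∀ i, B i ≤ β ^ κ
  ev : convergentSeries σ →+* E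
  ev_X : ∀ i, ev ⟨_, X_mem_convergentSeries i⟩ = (B i)⁻¹
  abs_ev_le : ∀ (c : convergentSeries σ) (N : ℕ),
    (∀ μ : σ →₀ ℕ, μ.degree < N → MvPowerSeries.coeff μ c.1 = 0) →
      ∃ K : ℕ, |ev c| ≤ K * (β ^ N)⁻¹
  le_abs_ev : ∀ c : convergentSeries σ, c ≠ 0 → ∃ C : ℕ, (β ^ C)⁻¹ ≤ |ev c|

namespace EvaluationSetup

variable {E : Type*} [Field E] [LinearOrder E] [IsStrictOrderedRing E] (S : EvaluationSetup σ E)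

theorem one_lt_β : 1 < S.β :=
  lt_of_lt_of_le (one_lt_two (α := E)) (by simpa using S.natCast_le 2)

theorem β_pos : 0 < S.β := one_pos.trans S.one_lt_β

theorem pow_β_mono {m n : ℕ} (h : m ≤ n) : S.β ^ m ≤ S.β ^ n :=
  pow_le_pow_right₀ S.one_lt_β.le h

theorem B_pos (i : σ) : 0 < S.B i := S.β_pos.trans_le (S.le_B i)

theorem ev_injective : Function.Injective S.ev := by
  rw [injective_iff_map_eq_zero]
  intro c hc
  by_contra h
  obtain ⟨C, hC⟩ := S.le_abs_ev c h
  rw [hc, abs_zero] at hC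
  exact absurd hC (not_le.2 (inv_pos.2 (pow_pos S.β_pos _)))

/-- The ring of elements of polynomial growth. -/
def polyBounded : Subring E where
  carrier := {x | ∃ C : ℕ, |x| ≤ S.β ^ C}
  mul_mem' := by
    rintro a b ⟨C, hC⟩ ⟨D, hD⟩
    refine ⟨C + D, ?_⟩
    rw [abs_mul, pow_add]
    exact mul_le_mul hC hD (abs_nonneg _) (pow_nonneg S.β_pos.le _)
  one_mem' := ⟨0, by simp⟩
  add_mem' := by
    rintro a b ⟨C, hC⟩ ⟨D, hD⟩
    refine ⟨max C D + 1, (abs_add_le _ _).trans ?_⟩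
    have h1 := hC.trans (S.pow_β_mono (le_max_left C D))
    have h2 := hD.trans (S.pow_β_mono (le_max_right C D))
    have h3 : (2 : E) ≤ S.β := by simpa using S.natCast_le 2
    rw [pow_succ]
    nlinarith [pow_pos S.β_pos (max C D)]
  zero_mem' := ⟨0, by simp⟩
  neg_mem' := by
    rintro a ⟨C, hC⟩
    exact ⟨C, by rwa [abs_neg]⟩

theorem mem_polyBounded_of_le {x y : E} (hy : y ∈ S.polyBounded) (h : |x| ≤ |y|) :
    x ∈ S.polyBounded := by
  obtain ⟨C, hC⟩ := hy
  exact ⟨C, h.trans hC⟩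

theorem exists_uniform_bound {ι : Type*} [Finite ι] {x : ι → E} (hx : ∀ i, x i ∈ S.polyBounded) :
    ∃ C : ℕ, ∀ i, |x i| ≤ S.β ^ C := by
  have := Fintype.ofFinite ι
  choose C hC using hx
  exact ⟨Finset.univ.sup C, fun i =>
    (hC i).trans (S.pow_β_mono (Finset.le_sup (Finset.mem_univ i)))⟩

/-- The field of quotients of integers of polynomial growth. -/
def boundedRationals : Subfield E where
  carrier := {x | ∃ p q : E, (p ∈ S.ints ∧ p ∈ S.polyBounded) ∧ (q ∈ S.ints ∧ q ∈ S.polyBounded) ∧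
    q ≠ 0 ∧ x = p / q}
  mul_mem' := by
    rintro _ _ ⟨p, q, hp, hq, hq0, rfl⟩ ⟨p', q', hp', hq', hq0', rfl⟩
    exact ⟨p * p', q * q', ⟨mul_mem hp.1 hp'.1, mul_mem hp.2 hp'.2⟩,
      ⟨mul_mem hq.1 hq'.1, mul_mem hq.2 hq'.2⟩, mul_ne_zero hq0 hq0', by field_simp⟩
  one_mem' := ⟨1, 1, ⟨one_mem _, one_mem _⟩, ⟨one_mem _, one_mem _⟩, one_ne_zero, by simp⟩
  add_mem' := by
    rintro _ _ ⟨p, q, hp, hq, hq0, rfl⟩ ⟨p', q', hp', hq', hq0', rfl⟩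
    exact ⟨p * q' + p' * q, q * q',
      ⟨add_mem (mul_mem hp.1 hq'.1) (mul_mem hp'.1 hq.1),
        add_mem (mul_mem hp.2 hq'.2) (mul_mem hp'.2 hq.2)⟩,
      ⟨mul_mem hq.1 hq'.1, mul_mem hq.2 hq'.2⟩, mul_ne_zero hq0 hq0', by field_simp⟩
  zero_mem' := ⟨0, 1, ⟨zero_mem _, zero_mem _⟩, ⟨one_mem _, one_mem _⟩, one_ne_zero, by simp⟩
  neg_mem' := by
    rintro _ ⟨p, q, hp, hq, hq0, rfl⟩
    exact ⟨-p, q, ⟨neg_mem hp.1, neg_mem hp.2⟩, hq, hq0, by rw [neg_div]⟩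
  inv_mem' := by
    rintro _ ⟨p, q, hp, hq, hq0, rfl⟩
    by_cases h : p = 0
    · exact ⟨0, 1, ⟨zero_mem _, zero_mem _⟩, ⟨one_mem _, one_mem _⟩, one_ne_zero, by simp [h]⟩
    · exact ⟨q, p, hq, hp, h, by rw [inv_div]⟩

theorem mem_boundedRationals {x : E} : x ∈ S.boundedRationals ↔
    ∃ p q : E, (p ∈ S.ints ∧ p ∈ S.polyBounded) ∧ (q ∈ S.ints ∧ q ∈ S.polyBounded) ∧
    q ≠ 0 ∧ x = p / q := Iff.rfl

/-- The field generated by the values of convergent power series. -/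
def values : Subfield E := Subfield.closure (Set.range S.ev)

/-- The field generated by the point. -/
def base : Subfield E := Subfield.closure (Set.range S.B)

theorem mem_values {x : E} : x ∈ S.values ↔ ∃ a b, b ≠ 0 ∧ x = S.ev a / S.ev b := by
  rw [values, Subfield.mem_closure_iff]
  have h : Subring.closure (Set.range S.ev) = S.ev.range := by
    rw [← RingHom.coe_range, Subring.closure_eq]
  rw [h]
  constructor
  · rintro ⟨_, ⟨a, rfl⟩, _, ⟨b, rfl⟩, rfl⟩
    by_cases hb : b = 0
    · exact ⟨0, 1, one_ne_zero, by simp [hb]⟩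
    · exact ⟨a, b, hb, rfl⟩
  · rintro ⟨a, b, -, rfl⟩
    exact ⟨_, ⟨a, rfl⟩, _, ⟨b, rfl⟩, rfl⟩

theorem ev_mem_values (c : convergentSeries σ) : S.ev c ∈ S.values :=
  Subfield.subset_closure ⟨c, rfl⟩

theorem B_mem_base (i : σ) : S.B i ∈ S.base := Subfield.subset_closure ⟨i, rfl⟩

theorem B_mem_polyBounded (i : σ) : S.B i ∈ S.polyBounded :=
  ⟨S.κ, by rw [abs_of_pos (S.B_pos i)]; exact S.B_le i⟩

theorem base_le_boundedRationals : S.base ≤ S.boundedRationals := by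
  refine Subfield.closure_le.2 ?_
  rintro _ ⟨i, rfl⟩
  exact ⟨S.B i, 1, ⟨S.B_mem i, S.B_mem_polyBounded i⟩, ⟨one_mem _, one_mem _⟩, one_ne_zero, by simp⟩

theorem base_le_values : S.base ≤ S.values := by
  refine Subfield.closure_le.2 ?_
  rintro _ ⟨i, rfl⟩
  have := S.values.inv_mem (S.ev_mem_values ⟨_, X_mem_convergentSeries i⟩)
  rwa [S.ev_X, inv_inv] at this

theorem boundedRationals_le_polyBounded {x : E} (hx : x ∈ S.boundedRationals) :
    x ∈ S.polyBounded := by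
  obtain ⟨p, q, hp, hq, hq0, rfl⟩ := hx
  refine S.mem_polyBounded_of_le hp.2 ?_
  rw [abs_div]
  exact div_le_self (abs_nonneg _) (S.one_le_abs q hq.1 hq0)

theorem ev_mem_polyBounded (c : convergentSeries σ) : S.ev c ∈ S.polyBounded := by
  obtain ⟨K, hK⟩ := S.abs_ev_le c 0 (by simp)
  exact ⟨1, by simpa using hK.trans (by simpa using S.natCast_le K)⟩

theorem values_le_polyBounded {x : E} (hx : x ∈ S.values) : x ∈ S.polyBounded := by
  obtain ⟨a, b, hb, rfl⟩ := S.mem_values.1 hx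
  obtain ⟨C, hC⟩ := S.le_abs_ev b hb
  rw [div_eq_mul_inv]
  refine mul_mem (S.ev_mem_polyBounded a) ⟨C, ?_⟩
  rw [abs_inv]
  exact inv_le_of_inv_le₀ (pow_pos S.β_pos _) hC

theorem exists_common_denominator {ι : Type*} [Finite ι] {x : ι → E} (hx : ∀ i, x i ∈ S.values) :
    ∃ D : convergentSeries σ, D ≠ 0 ∧ ∃ a : ι → convergentSeries σ,
      ∀ i, S.ev D * x i = S.ev (a i) := by
  classical
  have := Fintype.ofFinite ι
  choose a b hb hab using fun i => S.mem_values.1 (hx i)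
  refine ⟨∏ i, b i, Finset.prod_ne_zero_iff.2 fun i _ => hb i,
    fun i => a i * ∏ j ∈ Finset.univ.erase i, b j, fun i => ?_⟩
  rw [← Finset.mul_prod_erase _ _ (Finset.mem_univ i), hab, map_mul, map_mul]
  have : S.ev (b i) ≠ 0 := fun h => hb i (S.ev_injective (h.trans (map_zero _).symm))
  field_simp

theorem ev_convergentMonomial (ν : σ →₀ ℕ) :
    S.ev (convergentMonomial ν) = monomialValue (fun i => (S.B i)⁻¹) ν := by
  simp only [convergentMonomial, monomialValue, map_prod, map_pow, S.ev_X]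

theorem ev_convergentMonomial_mem_base (ν : σ →₀ ℕ) : S.ev (convergentMonomial ν) ∈ S.base := by
  rw [S.ev_convergentMonomial]
  exact prod_mem fun i _ => pow_mem (inv_mem (S.B_mem_base i)) _

theorem prod_B_pow_mul_mem {δ : ℕ} {ν : σ →₀ ℕ} (hν : ∀ i, ν i ≤ δ) :
    (∏ i, S.B i ^ δ) * S.ev (convergentMonomial ν) ∈ S.ints := by
  rw [S.ev_convergentMonomial, monomialValue, ← Finset.prod_mul_distrib]
  refine prod_mem fun i _ => ?_
  rw [inv_pow, ← pow_sub₀ _ (S.B_pos i).ne' (hν i)]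
  exact pow_mem (S.B_mem i) _

theorem exists_degree_lt {m d k r T : ℕ} (h : d * k ^ r < m) :
    ∃ δ : ℕ, d * (k * δ + T) ^ r < m * (δ + 1) ^ r := by
  have h1 : Tendsto (fun δ : ℕ => (d : ℝ) * ((k : ℝ) + ((T : ℝ) - k) * (1 / ((δ : ℝ) + 1))) ^ r)
      atTop (𝓝 ((d : ℝ) * ((k : ℝ) + ((T : ℝ) - k) * 0) ^ r)) :=
    ((tendsto_one_div_add_atTop_nhds_zero_nat.const_mul _).const_add _ |>.pow r).const_mul _
  have h2 : (d : ℝ) * ((k : ℝ) + ((T : ℝ) - k) * 0) ^ r < m := by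
    rw [mul_zero, add_zero]; exact_mod_cast h
  obtain ⟨δ, hδ⟩ := (h1.eventually_lt_const h2).exists
  refine ⟨δ, ?_⟩
  have h3 : (0 : ℝ) < (δ : ℝ) + 1 := by positivity
  have h4 : (k : ℝ) + ((T : ℝ) - k) * (1 / ((δ : ℝ) + 1)) = (k * δ + T) / (δ + 1) := by
    field_simp; ring
  rw [h4, div_pow, ← mul_div_assoc, div_lt_iff₀ (by positivity)] at hδ
  exact_mod_cast hδ

theorem coeff_mul_convergent (c d : convergentSeries σ) (p : ℤ) (μ : σ →₀ ℕ) :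
    MvPowerSeries.coeff μ (((p : convergentSeries σ) * c * d : convergentSeries σ) :
      MvPowerSeries σ ℚ) = p * MvPowerSeries.coeff μ ((c * d : convergentSeries σ) :
      MvPowerSeries σ ℚ) := by
  rw [mul_assoc, Subalgebra.coe_mul, coe_intCast_convergentSeries, MvPowerSeries.coeff_C_mul]

/-- A family of quotients of integers of polynomial growth which is linearly independent over the
base field spans a space of comparable dimension over the field of values of power series. -/
theorem card_le_mul_finrank {ι : Type*} [Fintype ι] {w : ι → E}
    (hw : ∀ g, w g ∈ S.boundedRationals) (hli : LinearIndependent S.base w) :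
    Fintype.card ι ≤ Set.finrank S.values (Set.range w) *
      (S.κ * Fintype.card σ) ^ Fintype.card σ := by
  classical
  by_contra hlt
  rw [not_le] at hlt
  set V := Submodule.span S.values (Set.range w)
  have hVfin : FiniteDimensional S.values V :=
    FiniteDimensional.span_of_finite _ (Set.finite_range w)
  set d := Set.finrank S.values (Set.range w) with hd
  let y : Module.Basis (Fin d) S.values V := Module.finBasis S.values V
  let c : ι → Fin d → S.values := fun g i => y.repr ⟨w g, Submodule.subset_span ⟨g, rfl⟩⟩ i
  have hc : ∀ g, w g = ∑ i, (c g i : E) * (y i : E) := by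
    intro g
    have h := congrArg (Subtype.val) (y.sum_repr ⟨w g, Submodule.subset_span ⟨g, rfl⟩⟩)
    rw [AddSubmonoidClass.coe_finsetSum] at h
    exact h.symm
  have hspan : ∀ v ∈ V, v ∈ S.polyBounded := by
    intro v hv
    induction hv using Submodule.span_induction with
    | mem x hx =>
      obtain ⟨g, rfl⟩ := hx
      exact S.boundedRationals_le_polyBounded (hw g)
    | zero => exact zero_mem _
    | add x y _ _ hx hy => exact add_mem hx hy
    | smul a x _ hx => exact mul_mem (S.values_le_polyBounded a.2) hx
  obtain ⟨C₁, hC₁⟩ := S.exists_uniform_bound (x := fun i => (y i : E)) fun i => hspan _ (y i).2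
  obtain ⟨D, hD0, a', ha'⟩ := S.exists_common_denominator (ι := ι × Fin d)
    (x := fun gi => (c gi.1 gi.2 : E)) fun gi => (c gi.1 gi.2).2
  let a : ι → Fin d → convergentSeries σ := fun g i => a' (g, i)
  have ha : ∀ g i, S.ev D * c g i = S.ev (a g i) := fun g i => ha' (g, i)
  obtain ⟨C₂, hC₂⟩ := S.le_abs_ev D hD0
  choose p q hp hq hq0 hpq using fun g => S.mem_boundedRationals.1 (hw g)
  obtain ⟨C, hC⟩ := S.exists_uniform_bound (x := q) fun g => (hq g).2
  set m := Fintype.card ι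
  set r := Fintype.card σ
  let T := m * C + C₁ + C₂ + 2
  obtain ⟨δ, hδ⟩ := exists_degree_lt (T := T) hlt
  let N := S.κ * r * δ + T
  let e : (σ → Fin (δ + 1)) → σ →₀ ℕ := fun ν => Finsupp.equivFunOnFinite.symm fun s => (ν s : ℕ)
  have he : Function.Injective e := by
    intro ν ν' h
    funext s
    exact Fin.ext (DFunLike.congr_fun h s)
  let e' : (σ → Fin N) → σ →₀ ℕ := fun ν => Finsupp.equivFunOnFinite.symm fun s => (ν s : ℕ)
  obtain ⟨P, hP0, hP⟩ := exists_int_solution (α := ι × (σ → Fin (δ + 1)))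
    (γ := Fin d × (σ → Fin N)) (fun iμ gν => MvPowerSeries.coeff (e' iμ.2)
      ((convergentMonomial (e gν.2) * a gν.1 iμ.1 : convergentSeries σ) : MvPowerSeries σ ℚ)) (by
      simpa using hδ)
  let Q : ι → convergentSeries σ := fun g =>
    ∑ ν, (P (g, ν) : convergentSeries σ) * convergentMonomial (e ν)
  obtain ⟨⟨g₀, ν₀⟩, hg₀⟩ : ∃ x, P x ≠ 0 := by
    by_contra h
    push Not at h
    exact hP0 (funext h)
  have hQ0 : Q g₀ ≠ 0 := by
    intro h
    have := coeff_sum_smul_convergentMonomial e he (fun ν => P (g₀, ν)) ν₀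
    rw [show (∑ ν, (P (g₀, ν) : convergentSeries σ) * convergentMonomial (e ν)) = Q g₀ from rfl,
      h, ZeroMemClass.coe_zero, map_zero] at this
    exact hg₀ (by exact_mod_cast this.symm)
  have hQbase : ∀ g, S.ev (Q g) ∈ S.base := by
    intro g
    simp only [Q, map_sum, map_mul, map_intCast]
    exact sum_mem fun ν _ => mul_mem (intCast_mem _ _) (S.ev_convergentMonomial_mem_base _)
  have hQvan : ∀ i, ∀ μ : σ →₀ ℕ, μ.degree < N →
      MvPowerSeries.coeff μ ((∑ g, Q g * a g i : convergentSeries σ) : MvPowerSeries σ ℚ) = 0 := by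
    intro i μ hμ
    have hμ' : ∀ s, μ s < N := fun s => lt_of_le_of_lt (by
      rw [Finsupp.degree_eq_sum]
      exact Finset.single_le_sum (f := fun i => μ i) (fun _ _ => Nat.zero_le _)
          (Finset.mem_univ s)) hμ
    have h := hP (i, fun s => ⟨μ s, hμ' s⟩)
    have hμe : e' (fun s => ⟨μ s, hμ' s⟩) = μ := by ext s; rfl
    simp only [hμe] at h
    rw [Fintype.sum_prod_type] at h
    rw [AddSubmonoidClass.coe_finsetSum, map_sum, ← h]
    refine Finset.sum_congr rfl fun g _ => ?_
    rw [Finset.sum_mul, AddSubmonoidClass.coe_finsetSum, map_sum]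
    exact Finset.sum_congr rfl fun ν _ => coeff_mul_convergent _ _ _ _
  let x : E := ∑ g, S.ev (Q g) * w g
  have hx0 : x ≠ 0 := by
    intro h
    have h2 := Fintype.linearIndependent_iff.1 hli (fun g => ⟨S.ev (Q g), hQbase g⟩) h g₀
    exact hQ0 (S.ev_injective ((congrArg Subtype.val h2).trans (map_zero _).symm))
  have hDx : S.ev D * x = ∑ i, S.ev (∑ g, Q g * a g i) * y i := by
    simp only [x, map_sum, map_mul, ← ha, Finset.sum_mul, Finset.mul_sum]
    rw [Finset.sum_comm]
    refine Finset.sum_congr rfl fun g _ => ?_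
    rw [hc g, Finset.mul_sum, Finset.mul_sum]
    refine Finset.sum_congr rfl fun i _ => ?_
    ring
  have hup : |S.ev D * x| ≤ S.β ^ (C₁ + 1) * (S.β ^ N)⁻¹ := by
    choose K hK using fun i => S.abs_ev_le (∑ g, Q g * a g i) N (hQvan i)
    rw [hDx]
    refine (Finset.abs_sum_le_sum_abs _ _).trans ?_
    have h1 : ∀ i, |S.ev (∑ g, Q g * a g i) * y i| ≤ K i * ((S.β ^ N)⁻¹ * S.β ^ C₁) := by
      intro i
      rw [abs_mul, ← mul_assoc]
      exact mul_le_mul (hK i) (hC₁ i) (abs_nonneg _)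
        (mul_nonneg (Nat.cast_nonneg _) (inv_nonneg.2 (pow_nonneg S.β_pos.le _)))
    refine (Finset.sum_le_sum fun i _ => h1 i).trans ?_
    rw [← Finset.sum_mul, ← Nat.cast_sum, pow_succ]
    have h2 := mul_le_mul_of_nonneg_right (S.natCast_le (∑ i, K i))
      (mul_nonneg (inv_nonneg.2 (pow_nonneg S.β_pos.le N)) (pow_nonneg S.β_pos.le C₁))
    refine h2.trans (le_of_eq (by ring))
  have hlow : (S.β ^ (m * C + S.κ * r * δ))⁻¹ ≤ |x| := by
    let A : E := (∏ g, q g) * ∏ i, S.B i ^ δ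
    have hA0 : A ≠ 0 := mul_ne_zero (Finset.prod_ne_zero_iff.2 fun g _ => hq0 g)
      (Finset.prod_ne_zero_iff.2 fun i _ => pow_ne_zero _ (S.B_pos i).ne')
    have hAx : A * x ∈ S.ints := by
      simp only [x, Q, map_sum, map_mul, map_intCast, Finset.mul_sum, Finset.sum_mul]
      refine sum_mem fun g _ => sum_mem fun ν _ => ?_
      have h1 : A * (P (g, ν) * S.ev (convergentMonomial (e ν)) * w g) =
          (∏ j ∈ Finset.univ.erase g, q j) * p g * P (g, ν) *
            ((∏ i, S.B i ^ δ) * S.ev (convergentMonomial (e ν))) := by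
        simp only [A]
        rw [← Finset.mul_prod_erase _ _ (Finset.mem_univ g), hpq g]
        have := hq0 g
        field_simp
      rw [h1]
      refine mul_mem (mul_mem (mul_mem (prod_mem fun j _ => (hq j).1) (hp g).1)
        (intCast_mem _ _)) (S.prod_B_pow_mul_mem fun i => ?_)
      exact Nat.lt_succ_iff.1 (ν i).2
    have h1 := S.one_le_abs _ hAx (mul_ne_zero hA0 hx0)
    have hAle : |A| ≤ S.β ^ (m * C + S.κ * r * δ) := by
      simp only [A]
      rw [abs_mul, pow_add, Finset.abs_prod, Finset.abs_prod]
      refine mul_le_mul ?_ ?_ (Finset.prod_nonneg fun _ _ => abs_nonneg _)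
        (pow_nonneg S.β_pos.le _)
      · refine (Finset.prod_le_prod (fun _ _ => abs_nonneg _) fun g _ => hC g).trans (le_of_eq ?_)
        rw [Finset.prod_const, Finset.card_univ, ← pow_mul, mul_comm]
      · refine (Finset.prod_le_prod (g := fun _ => S.β ^ (S.κ * δ)) (fun _ _ => abs_nonneg _)
          fun i _ => ?_).trans (le_of_eq ?_)
        · rw [abs_of_pos (pow_pos (S.B_pos i) _), pow_mul]
          exact pow_le_pow_left₀ (S.B_pos i).le (S.B_le i) _
        · rw [Finset.prod_const, Finset.card_univ, ← pow_mul]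
          congr 1
          ring
    rw [abs_mul] at h1
    rw [inv_le_iff_one_le_mul₀ (pow_pos S.β_pos _)]
    refine h1.trans ?_
    rw [mul_comm]
    exact mul_le_mul_of_nonneg_left hAle (abs_nonneg _)
  have hfin : (S.β ^ C₂)⁻¹ * (S.β ^ (m * C + S.κ * r * δ))⁻¹ ≤
      S.β ^ (C₁ + 1) * (S.β ^ N)⁻¹ := by
    refine le_trans ?_ hup
    rw [abs_mul]
    exact mul_le_mul hC₂ hlow (inv_nonneg.2 (pow_nonneg S.β_pos.le _)) (abs_nonneg _)
  rw [← mul_inv, ← pow_add, ← div_eq_mul_inv, le_div_iff₀ (pow_pos S.β_pos _),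
    inv_mul_le_iff₀ (pow_pos S.β_pos _), ← pow_add] at hfin
  have := (pow_le_pow_iff_right₀ S.one_lt_β).1 hfin
  simp only [N, T] at this
  omega

end EvaluationSetup

end EvaluationSetup

section Scales

open Filter Topology

variable {σ : Type*} [Fintype σ]

/-- Integer scales `B n i` growing along an ultrafilter, all polynomially comparable with `β n`, and
such that distinct monomials in them have distinct orders of magnitude. -/
structure Scales (σ : Type*) [Fintype σ] where
  U : Ultrafilter ℕ
  B : ℕ → σ → ℕ
  two_le_B : ∀ n i, 2 ≤ B n i
  β : ℕ → ℝ
  tendsto_β : Tendsto β U atTop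
  κ : ℕ
  le_B : ∀ i, ∀ᶠ n in U, β n ≤ B n i
  B_le : ∀ i, ∀ᶠ n in U, (B n i : ℝ) ≤ β n ^ κ
  comparable : ∀ μ ν : σ →₀ ℕ, μ ≠ ν →
    Tendsto (fun n => monomialValue (fun i => (B n i : ℝ)⁻¹) μ /
      monomialValue (fun i => (B n i : ℝ)⁻¹) ν) U (𝓝 0) ∨
    Tendsto (fun n => monomialValue (fun i => (B n i : ℝ)⁻¹) ν /
      monomialValue (fun i => (B n i : ℝ)⁻¹) μ) U (𝓝 0)

namespace Scales

variable (T : Scales σ)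

/-- The points at which power series are evaluated. -/
def z (n : ℕ) (i : σ) : ℝ := (T.B n i : ℝ)⁻¹

theorem z_pos (n : ℕ) (i : σ) : 0 < T.z n i :=
  inv_pos.2 (Nat.cast_pos.2 (by have := T.two_le_B n i; omega))

theorem z_nonneg (n : ℕ) (i : σ) : 0 ≤ T.z n i := (T.z_pos n i).le

theorem z_le_half (n : ℕ) (i : σ) : T.z n i ≤ 1 / 2 := by
  rw [z, one_div]
  exact inv_anti₀ two_pos (by exact_mod_cast T.two_le_B n i)

theorem eventually_z_le : ∀ᶠ n in T.U, ∀ i, T.z n i ≤ (T.β n)⁻¹ := by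
  rw [eventually_all]
  intro i
  filter_upwards [T.le_B i, T.tendsto_β.eventually_gt_atTop 0] with n h h0
  exact inv_anti₀ h0 h

theorem eventually_le_z : ∀ᶠ n in T.U, ∀ i, (T.β n ^ T.κ)⁻¹ ≤ T.z n i := by
  rw [eventually_all]
  intro i
  filter_upwards [T.B_le i] with n h
  exact inv_anti₀ (inv_pos.1 (T.z_pos n i)) h

theorem eventually_monomialValue_le (μ : σ →₀ ℕ) :
    ∀ᶠ n in T.U, (T.β n ^ (T.κ * μ.degree))⁻¹ ≤ monomialValue (T.z n) μ := by
  filter_upwards [T.eventually_le_z, T.tendsto_β.eventually_gt_atTop 0] with n h h0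
  rw [pow_mul, ← inv_pow, ← monomialValue_const]
  exact monomialValue_mono (fun _ => by positivity) h μ

/-- `z ^ μ` is infinitesimal with respect to `z ^ ν`. -/
def Dominated (μ ν : σ →₀ ℕ) : Prop :=
  Tendsto (fun n => monomialValue (T.z n) μ / monomialValue (T.z n) ν) T.U (𝓝 0)

theorem Dominated.trans {μ ν ρ : σ →₀ ℕ} (h : T.Dominated μ ν) (h' : T.Dominated ν ρ) :
    T.Dominated μ ρ := by
  have := Tendsto.mul h h'
  rw [mul_zero] at this
  refine this.congr fun n => ?_
  have := (monomialValue_pos (T.z_pos n) ν).ne'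
  field_simp

theorem exists_dominating {s : Finset (σ →₀ ℕ)} (hs : s.Nonempty) :
    ∃ μ ∈ s, ∀ ν ∈ s, ν ≠ μ → T.Dominated ν μ := by
  classical
  induction hs using Finset.Nonempty.cons_induction with
  | singleton a => exact ⟨a, by simp, fun ν hν h => absurd (Finset.mem_singleton.1 hν) h⟩
  | cons a s ha _ ih =>
    obtain ⟨μ, hμ, h⟩ := ih
    have hne : a ≠ μ := fun h => ha (h ▸ hμ)
    rcases T.comparable a μ hne with hd | hd
    · refine ⟨μ, Finset.mem_cons_of_mem hμ, fun ν hν hν' => ?_⟩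
      rcases Finset.mem_cons.1 hν with rfl | hν
      · exact hd
      · exact h ν hν hν'
    · refine ⟨a, Finset.mem_cons_self a s, fun ν hν hν' => ?_⟩
      rcases Finset.mem_cons.1 hν with rfl | hν
      · exact absurd rfl hν'
      · by_cases hνμ : ν = μ
        · exact hνμ ▸ hd
        · exact Dominated.trans T (h ν hν hνμ) hd

theorem eventually_div_le (μ : σ →₀ ℕ) : ∀ᶠ n in T.U, ∀ ν : σ →₀ ℕ,
    monomialValue (T.z n) ν / monomialValue (T.z n) μ ≤
      T.β n ^ (T.κ * μ.degree) * (T.β n)⁻¹ ^ ν.degree := by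
  filter_upwards [T.eventually_monomialValue_le μ, T.eventually_z_le,
    T.tendsto_β.eventually_gt_atTop 0] with n h h' h0 ν
  rw [div_eq_mul_inv, mul_comm]
  refine mul_le_mul ?_ ?_ (monomialValue_nonneg (T.z_nonneg n) ν) (by positivity)
  · exact inv_le_of_inv_le₀ (by positivity) h
  · rw [← monomialValue_const]
    exact monomialValue_mono (T.z_nonneg n) h' ν

theorem dominated_of_lt {μ ν : σ →₀ ℕ} (h : T.κ * μ.degree < ν.degree) : T.Dominated ν μ := by
  have h1 := T.tendsto_β.inv_tendsto_atTop
  refine squeeze_zero' (Eventually.of_forall fun n => ?_) ?_ h1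
  · exact div_nonneg (monomialValue_nonneg (T.z_nonneg n) ν)
      (monomialValue_nonneg (T.z_nonneg n) μ)
  · filter_upwards [T.eventually_div_le μ, T.tendsto_β.eventually_ge_atTop 1] with n hn h1
    refine (hn ν).trans ?_
    have h0 : 0 < T.β n := by linarith
    obtain ⟨k, hk⟩ := Nat.exists_eq_add_of_lt h
    rw [hk, pow_succ, pow_add, ← mul_assoc, ← mul_assoc, ← mul_pow, mul_inv_cancel₀ h0.ne', one_pow,
      one_mul]
    exact mul_le_of_le_one_left (by positivity)
      (pow_le_one₀ (by positivity) (inv_le_one_of_one_le₀ h1))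

theorem exists_leading_term {c : MvPowerSeries σ ℚ} (hc : c ≠ 0) :
    ∃ μ, MvPowerSeries.coeff μ c ≠ 0 ∧ ∀ ν, MvPowerSeries.coeff ν c ≠ 0 → ν ≠ μ →
      T.Dominated ν μ := by
  obtain ⟨μ₁, h₁⟩ : ∃ μ, MvPowerSeries.coeff μ c ≠ 0 := by
    by_contra! h
    exact hc (MvPowerSeries.ext fun μ => by simpa using h μ)
  have hfin := ((Finsupp.finite_of_degree_le (σ := σ) (T.κ * μ₁.degree)).union
    (Set.finite_singleton μ₁)).inter_of_left {μ | MvPowerSeries.coeff μ c ≠ 0}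
  obtain ⟨μ, hμ, h⟩ := T.exists_dominating (s := hfin.toFinset)
    ⟨μ₁, by simpa using h₁⟩
  rw [Set.Finite.mem_toFinset] at hμ
  refine ⟨μ, hμ.2, fun ν hν hνμ => ?_⟩
  by_cases hmem : ν ∈ hfin.toFinset
  · exact h ν hmem hνμ
  · have hd : T.Dominated ν μ₁ := by
      refine T.dominated_of_lt (not_le.1 fun hle => hmem ?_)
      rw [Set.Finite.mem_toFinset]
      exact ⟨Or.inl hle, hν⟩
    by_cases h1 : μ₁ = μ
    · exact h1 ▸ hd
    · exact Dominated.trans T hd (h μ₁ (by simpa using h₁) h1)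

/-- Evaluation of convergent series at the points `z n`. -/
def evalAt (n : ℕ) : convergentSeries σ →+* ℝ := evalSeries (T.z n) (T.z_nonneg n) (T.z_le_half n)

theorem tendsto_evalAt_div {c : convergentSeries σ} {μ : σ →₀ ℕ}
    (hμ : ∀ ν, MvPowerSeries.coeff ν c.1 ≠ 0 → ν ≠ μ → T.Dominated ν μ) :
    Tendsto (fun n => T.evalAt n c / monomialValue (T.z n) μ) T.U
      (𝓝 ((MvPowerSeries.coeff μ c.1 : ℚ) : ℝ)) := by
  classical
  set N := T.κ * μ.degree with hN
  have hself : ∀ n, monomialValue (T.z n) μ / monomialValue (T.z n) μ = 1 := fun n =>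
    div_self (monomialValue_pos (T.z_pos n) μ).ne'
  have key : Tendsto (fun n => ∑' ν, seriesTerm (T.z n) c.1 ν / monomialValue (T.z n) μ) T.U
      (𝓝 (∑' ν, if ν = μ then ((MvPowerSeries.coeff μ c.1 : ℚ) : ℝ) else 0)) := by
    refine tendsto_tsum_of_dominated_convergence (bound := fun ν => 2 ^ N * halfTerm c.1 ν)
      ((mem_convergentSeries.1 c.2).mul_left _) ?_ ?_
    · intro ν
      by_cases hν : ν = μ
      · subst hν
        simp only [if_true, seriesTerm, mul_div_assoc, hself, mul_one]
        exact tendsto_const_nhds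
      · rw [if_neg hν]
        by_cases h0 : MvPowerSeries.coeff ν c.1 = 0
        · simp [seriesTerm, h0]
        · have := (hμ ν h0 hν).const_mul ((MvPowerSeries.coeff ν c.1 : ℚ) : ℝ)
          rw [mul_zero] at this
          simpa only [seriesTerm, mul_div_assoc] using this
    · have hsmall : ∀ᶠ n in T.U, ∀ ν ∈ {ν : σ →₀ ℕ | ν.degree ≤ N},
          MvPowerSeries.coeff ν c.1 ≠ 0 →
          monomialValue (T.z n) ν / monomialValue (T.z n) μ ≤ 1 := by
        rw [eventually_all_finite (Finsupp.finite_of_degree_le N)]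
        intro ν _
        by_cases h0 : MvPowerSeries.coeff ν c.1 = 0
        · simp [h0]
        · by_cases hν : ν = μ
          · subst hν
            simp [hself]
          · filter_upwards [(hμ ν h0 hν).eventually_le_const one_pos] with n hn _
            exact hn
      filter_upwards [hsmall, T.eventually_div_le μ, T.tendsto_β.eventually_ge_atTop 2]
        with n h1 h2 h3 ν
      by_cases h0 : MvPowerSeries.coeff ν c.1 = 0
      · simp [seriesTerm, halfTerm, h0]
      have hnn : 0 ≤ monomialValue (T.z n) ν / monomialValue (T.z n) μ :=
        div_nonneg (monomialValue_nonneg (T.z_nonneg n) ν)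
          (monomialValue_nonneg (T.z_nonneg n) μ)
      rw [seriesTerm, mul_div_assoc, Real.norm_eq_abs, abs_mul, abs_of_nonneg hnn, halfTerm,
        mul_left_comm]
      refine mul_le_mul_of_nonneg_left ?_ (abs_nonneg _)
      rw [monomialValue_const]
      rcases le_or_gt ν.degree N with hle | hlt
      · refine (h1 ν hle h0).trans ?_
        obtain ⟨k, hk⟩ := Nat.exists_eq_add_of_le hle
        rw [hk, pow_add, mul_right_comm, ← mul_pow]
        norm_num
        exact one_le_pow₀ one_le_two
      · refine (h2 ν).trans ?_
        obtain ⟨k, hk⟩ := Nat.exists_eq_add_of_lt hlt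
        have hβ : 0 < T.β n := by linarith
        rw [hk, add_assoc, pow_add, ← hN, pow_add (1 / 2 : ℝ), ← mul_assoc, ← mul_assoc, ← mul_pow,
          ← mul_pow, mul_inv_cancel₀ hβ.ne', mul_one_div_cancel two_ne_zero, one_pow, one_mul, one_mul,
          one_div]
        exact pow_le_pow_left₀ (by positivity) (inv_anti₀ two_pos h3) _
  rw [tsum_ite_eq] at key
  refine key.congr fun n => ?_
  rw [tsum_div_const]
  rfl

theorem eventually_le_abs_evalAt {c : convergentSeries σ} (hc : c ≠ 0) :
    ∃ C : ℕ, ∀ᶠ n in T.U, (T.β n ^ C)⁻¹ ≤ |T.evalAt n c| := by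
  obtain ⟨μ, h0, hμ⟩ := T.exists_leading_term (c := c.1) (fun h => hc (Subtype.ext h))
  have hpos : 0 < |((MvPowerSeries.coeff μ c.1 : ℚ) : ℝ)| := abs_pos.2 (Rat.cast_ne_zero.2 h0)
  refine ⟨1 + T.κ * μ.degree, ?_⟩
  filter_upwards [(T.tendsto_evalAt_div hμ).abs.eventually_const_le (half_lt_self hpos),
    T.eventually_monomialValue_le μ, T.tendsto_β.eventually_ge_atTop 1,
    T.tendsto_β.inv_tendsto_atTop.eventually_le_const (half_pos hpos)] with n h1 h2 h3 h4
  have hm := monomialValue_pos (T.z_pos n) μ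
  rw [abs_div, abs_of_pos hm, le_div_iff₀ hm] at h1
  refine le_trans ?_ h1
  rw [pow_add, pow_one, mul_inv]
  exact mul_le_mul h4 h2 (by positivity) (by positivity)

/-- The field of germs of real sequences. -/
abbrev Field : Type := (T.U : Filter ℕ).Germ ℝ

/-- The ring of germs of integer sequences. -/
def intGerms : Subring T.Field where
  carrier := {x | ∃ f : ℕ → ℤ, x = ((fun n => (f n : ℝ) : ℕ → ℝ) : T.Field)}
  mul_mem' := by
    rintro _ _ ⟨f, rfl⟩ ⟨g, rfl⟩
    exact ⟨fun n => f n * g n, by rw [← Germ.coe_mul]; congr; ext n; simp⟩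
  one_mem' := ⟨fun _ => 1, by rw [← Germ.coe_one]; congr; ext n; simp⟩
  add_mem' := by
    rintro _ _ ⟨f, rfl⟩ ⟨g, rfl⟩
    exact ⟨fun n => f n + g n, by rw [← Germ.coe_add]; congr; ext n; simp⟩
  zero_mem' := ⟨fun _ => 0, by rw [← Germ.coe_zero]; congr; ext n; simp⟩
  neg_mem' := by
    rintro _ ⟨f, rfl⟩
    exact ⟨fun n => - f n, by rw [← Germ.coe_neg]; congr; ext n; simp⟩

theorem abs_coe_eq (f : ℕ → ℝ) :
    |((f : ℕ → ℝ) : T.Field)| = ((fun n => |f n| : ℕ → ℝ) : T.Field) := by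
  rw [Germ.abs_def]
  rfl

theorem coe_natCast (n : ℕ) : ((n : ℕ) : T.Field) = ((fun _ => (n : ℝ) : ℕ → ℝ) : T.Field) := rfl

/-- The evaluation setup on the field of germs attached to a system of scales. -/
def setup : EvaluationSetup σ T.Field where
  ints := T.intGerms
  one_le_abs := by
    rintro _ ⟨f, rfl⟩ h
    rw [abs_coe_eq, ← Germ.coe_one, Germ.coe_le]
    have h' : ∀ᶠ n in T.U, f n ≠ 0 := by
      refine Ultrafilter.eventually_not.2 fun h0 => ?_
      refine h (Germ.coe_eq.2 ?_)
      filter_upwards [h0] with n hn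
      simp [hn]
    filter_upwards [h'] with n hn
    rw [Pi.one_apply, ← Int.cast_abs]
    exact_mod_cast Int.one_le_abs hn
  β := (T.β : T.Field)
  natCast_le n := by
    rw [coe_natCast, Germ.coe_le]
    exact T.tendsto_β.eventually_ge_atTop _
  κ := T.κ
  B i := ((fun n => (T.B n i : ℝ) : ℕ → ℝ) : T.Field)
  B_mem i := ⟨fun n => T.B n i, by simp⟩
  le_B i := Germ.coe_le.2 (T.le_B i)
  B_le i := by
    rw [← Germ.coe_pow, Germ.coe_le]
    exact T.B_le i
  ev := (Germ.coeRingHom _).comp (RingHom.pi T.evalAt)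
  ev_X i := by
    rw [← Germ.coe_inv]
    refine congrArg Germ.ofFun (funext fun n => ?_)
    exact evalSeries_X (T.z n) (T.z_nonneg n) (T.z_le_half n) i
  abs_ev_le c N hN := by
    obtain ⟨K, hK⟩ := exists_nat_ge (2 ^ N * ∑' μ, halfTerm c.1 μ)
    refine ⟨K, ?_⟩
    change |((fun n => T.evalAt n c : ℕ → ℝ) : T.Field)| ≤ _
    rw [abs_coe_eq, coe_natCast, ← Germ.coe_pow, ← Germ.coe_inv, ← Germ.coe_mul, Germ.coe_le]
    filter_upwards [T.eventually_z_le, T.tendsto_β.eventually_ge_atTop 2] with n h1 h2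
    have h0 : 0 < T.β n := by linarith
    refine (abs_evalSeries_le (T.z n) (T.z_nonneg n) (T.z_le_half n) (t := (T.β n)⁻¹)
      (by positivity) ?_ h1 c N hN).trans ?_
    · rw [one_div]; exact inv_anti₀ two_pos h2
    · rw [mul_pow, mul_right_comm, inv_pow]
      exact mul_le_mul_of_nonneg_right hK (by positivity)
  le_abs_ev c hc := by
    obtain ⟨C, hC⟩ := T.eventually_le_abs_evalAt hc
    refine ⟨C, ?_⟩
    change _ ≤ |((fun n => T.evalAt n c : ℕ → ℝ) : T.Field)|
    rw [abs_coe_eq, ← Germ.coe_pow, ← Germ.coe_inv, Germ.coe_le]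
    exact hC

end Scales

end Scales

section Freeness

open Module

theorem exists_pow_gap (d e k : ℕ) :
    ∃ N : ℕ, (N + e + 1) ^ d > k * ((N + e + 1) ^ d - (N + 1) ^ d) := by
  refine ⟨k * (d * e), ?_⟩
  set N := k * (d * e)
  have hle : (N + 1) ^ d ≤ (N + e + 1) ^ d := Nat.pow_le_pow_left (by omega) d
  have h : (k : ℝ) * (((N + e + 1 : ℕ) : ℝ) ^ d - ((N + 1 : ℕ) : ℝ) ^ d) <
      ((N + e + 1 : ℕ) : ℝ) ^ d := by
    have hM : (0 : ℝ) < ((N + e + 1 : ℕ) : ℝ) := by positivity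
    set M : ℝ := ((N + e + 1 : ℕ) : ℝ) with hMdef
    have he : (e : ℝ) ≤ M := by rw [hMdef]; push_cast; linarith [Nat.cast_nonneg (α := ℝ) N]
    have hb := one_add_mul_le_pow (a := -(e / M : ℝ)) (by
      have : (e : ℝ) / M ≤ 1 := div_le_one_of_le₀ he hM.le
      linarith) d
    have h1 : ((N + 1 : ℕ) : ℝ) = M * (1 + -(e / M)) := by
      rw [hMdef]; push_cast; field_simp; ring
    rw [h1, mul_pow]
    have h2 : (k : ℝ) * (d * e) < M := by
      rw [hMdef]; push_cast
      have : ((k * (d * e) : ℕ) : ℝ) = (N : ℝ) := rfl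
      push_cast at this
      linarith [Nat.cast_nonneg (α := ℝ) e]
    have h3 : M ^ d - M ^ d * (1 + -(e / M)) ^ d ≤ M ^ d * (d * (e / M)) := by
      have := mul_le_mul_of_nonneg_left hb (pow_nonneg hM.le d)
      linarith
    have h4 : (k : ℝ) * (M ^ d * (d * (e / M))) = M ^ d * (k * (d * e) / M) := by ring
    have h5 : (k : ℝ) * (d * e) / M < 1 := (div_lt_one hM).2 h2
    calc _ ≤ (k : ℝ) * (M ^ d * (d * (e / M))) := mul_le_mul_of_nonneg_left h3 (by positivity)
      _ = M ^ d * (k * (d * e) / M) := h4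
      _ < M ^ d * 1 := mul_lt_mul_of_pos_left h5 (by positivity)
      _ = M ^ d := mul_one _
  rw [gt_iff_lt]
  have hcast : ((k * ((N + e + 1) ^ d - (N + 1) ^ d) : ℕ) : ℝ) < ((N + e + 1) ^ d : ℕ) := by
    rw [Nat.cast_mul, Nat.cast_sub hle]
    push_cast at h ⊢
    exact h
  exact_mod_cast hcast

/-- Exponent vectors with all entries at most `n`. -/
def boxEquiv (ι : Type*) [Finite ι] (n : ℕ) :
    {m : ι →₀ ℕ | ∀ i, m i ≤ n} ≃ (ι → Fin (n + 1)) where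
  toFun m i := ⟨m.1 i, Nat.lt_succ_of_le (m.2 i)⟩
  invFun g := ⟨Finsupp.equivFunOnFinite.symm fun i => g i, fun i => Nat.le_of_lt_succ (g i).2⟩
  left_inv m := by ext; simp
  right_inv g := by ext; simp

instance (ι : Type*) [Finite ι] (n : ℕ) : Finite {m : ι →₀ ℕ | ∀ i, m i ≤ n} :=
  Finite.of_equiv _ (boxEquiv ι n).symm

theorem card_box (ι : Type*) [Fintype ι] (n : ℕ) :
    Nat.card {m : ι →₀ ℕ | ∀ i, m i ≤ n} = (n + 1) ^ Fintype.card ι := by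
  classical
  rw [Nat.card_congr (boxEquiv ι n), Nat.card_eq_fintype_card]
  simp

theorem finrank_restrictDegree (ι K : Type*) [Fintype ι] [Field K] (n : ℕ) :
    finrank K (MvPolynomial.restrictDegree ι K n) = (n + 1) ^ Fintype.card ι := by
  rw [← card_box ι n]
  exact finrank_eq_nat_card_basis (MvPolynomial.basisRestrictSupport K _)

/-- A family satisfying a nontrivial polynomial relation has few independent monomials in large
boxes. -/
theorem finrank_span_box_le {ι K E : Type*} [Fintype ι] [Field K] [Field E] [Algebra K E]
    {t : ι → E}
    {P : MvPolynomial ι K} (hP : P ≠ 0) (h0 : MvPolynomial.aeval t P = 0) {e : ℕ}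
    (he : P ∈ MvPolynomial.restrictDegree ι K e) (N : ℕ) :
    Set.finrank K (Set.range fun m : {m : ι →₀ ℕ | ∀ i, m i ≤ N + e} => ∏ i, t i ^ m.1 i) ≤
      (N + e + 1) ^ Fintype.card ι - (N + 1) ^ Fintype.card ι := by
  set W := MvPolynomial.restrictDegree ι K (N + e)
  set φ : W →ₗ[K] E := (MvPolynomial.aeval t).toLinearMap ∘ₗ W.subtype with hφ
  have hmul : ∀ q ∈ MvPolynomial.restrictDegree ι K N, q * P ∈ W := by
    intro q hq
    refine MvPolynomial.restrictSupport_mono K ?_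
      ((MvPolynomial.restrictSupport_add (R := K) {m : ι →₀ ℕ | ∀ i, m i ≤ N}
        {m : ι →₀ ℕ | ∀ i, m i ≤ e}).symm.le (Submodule.mul_mem_mul hq he))
    rintro _ ⟨a, ha, b, hb, rfl⟩ i
    exact add_le_add (ha i) (hb i)
  let ψ : MvPolynomial.restrictDegree ι K N →ₗ[K] LinearMap.ker φ :=
    { toFun := fun q => ⟨⟨q.1 * P, hmul q.1 q.2⟩, by simp [φ, h0]⟩
      map_add' := fun a b => by ext : 2; simp [add_mul]
      map_smul' := fun c a => by ext : 2; simp }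
  have hψ : Function.Injective ψ := by
    intro a b hab
    have : a.1 * P = b.1 * P := congrArg (fun x => x.1.1) hab
    exact Subtype.ext (mul_right_cancel₀ hP this)
  have h1 := LinearMap.finrank_le_finrank_of_injective hψ
  have h2 := LinearMap.finrank_range_add_finrank_ker φ
  rw [finrank_restrictDegree] at h1 h2
  have h3 : Submodule.span K
      (Set.range fun m : {m : ι →₀ ℕ | ∀ i, m i ≤ N + e} => ∏ i, t i ^ m.1 i) ≤
      LinearMap.range φ := by
    rw [Submodule.span_le]
    rintro _ ⟨m, rfl⟩
    refine ⟨⟨MvPolynomial.monomial m.1 1, ?_⟩, ?_⟩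
    · exact (MvPolynomial.monomial_mem_restrictSupport K).2 (Or.inl m.2)
    · simp [φ, MvPolynomial.aeval_monomial, Finsupp.prod_fintype]
  have h4 : Set.finrank K (Set.range fun m : {m : ι →₀ ℕ | ∀ i, m i ≤ N + e} => ∏ i, t i ^ m.1 i) ≤
      finrank K (LinearMap.range φ) := Submodule.finrank_mono h3
  omega

theorem linearIndependent_box {ι F E : Type*} [Fintype ι] [Field F] [Field E] [Algebra F E]
    {t : ι → E} (ht : AlgebraicIndependent F t) (s : Set (ι →₀ ℕ)) :
    LinearIndependent F fun m : s => ∏ i, t i ^ m.1 i := by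
  have h := ((MvPolynomial.basisMonomials ι F).linearIndependent.map'
    (MvPolynomial.aeval t).toLinearMap (LinearMap.ker_eq_bot.2 ht)).comp (Subtype.val : s → _)
    Subtype.val_injective
  have he : (fun m : s => ∏ i, t i ^ m.1 i) = ((MvPolynomial.aeval t).toLinearMap ∘
      (MvPolynomial.basisMonomials ι F)) ∘ (Subtype.val : s → _) := by
    ext m
    simp [MvPolynomial.aeval_monomial, Finsupp.prod_fintype]
  rw [he]
  exact h

namespace EvaluationSetup

variable {σ : Type*} [Fintype σ] {E : Type*} [Field E] [LinearOrder E] [IsStrictOrderedRing E]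
  (S : EvaluationSetup σ E)

theorem algebraicIndependent_values {ι : Type*} {t : ι → E} (ht : ∀ i, t i ∈ S.boundedRationals)
    (h : AlgebraicIndependent S.base t) : AlgebraicIndependent S.values t := by
  classical
  refine algebraicIndependent_of_finite_type fun s hs => ?_
  have : Fintype s := hs.fintype
  have hF : AlgebraicIndependent S.base fun i : s => t i := h.comp _ Subtype.val_injective
  rw [AlgebraicIndependent, injective_iff_map_eq_zero]
  intro P h0
  by_contra hP
  obtain ⟨e, he⟩ : ∃ e, P ∈ MvPolynomial.restrictDegree s S.values e := by
    refine ⟨P.support.sup fun m => Finset.univ.sup m, ?_⟩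
    rw [MvPolynomial.mem_restrictDegree]
    intro m hm i
    exact (Finset.le_sup (f := m) (Finset.mem_univ i)).trans
      (Finset.le_sup (f := fun m : s →₀ ℕ => Finset.univ.sup m) hm)
  obtain ⟨N, hN⟩ := exists_pow_gap (Fintype.card s) e
    ((S.κ * Fintype.card σ) ^ Fintype.card σ)
  have h1 := finrank_span_box_le hP h0 he N
  let _ : Fintype {m : s →₀ ℕ | ∀ i, m i ≤ N + e} := Fintype.ofFinite _
  have h2 := S.card_le_mul_finrank
    (w := fun m : {m : s →₀ ℕ | ∀ i, m i ≤ N + e} => ∏ i : s, t i ^ m.1 i)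
    (fun m => prod_mem fun i _ => pow_mem (ht i) _) (linearIndependent_box hF _)
  rw [← Nat.card_eq_fintype_card, card_box] at h2
  exact absurd (h2.trans (Nat.mul_le_mul_right _ h1)) (not_le.2 (by rwa [mul_comm]))

end EvaluationSetup

end Freeness

section AlgebraicClosureOperator

variable {E : Type*} [Field E]

/-- The algebraic closure in `E` of the subfield generated by a set. -/
def acl (A : Set E) : Subfield E := (algebraicClosure (Subfield.closure A) E).toSubfield

theorem mem_acl {A : Set E} {y : E} : y ∈ acl A ↔ IsAlgebraic (Subfield.closure A) y :=
  mem_algebraicClosure_iff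

theorem subset_acl (A : Set E) : A ⊆ acl A := fun y hy =>
  mem_acl.2 (isAlgebraic_algebraMap (⟨y, Subfield.subset_closure hy⟩ : Subfield.closure A))

theorem mem_acl_of_isAlgebraic {R : Type*} [CommRing R] [Algebra R E]
    (hinj : Function.Injective (algebraMap R E)) {B : Set E}
    (hB : ∀ r, algebraMap R E r ∈ acl B) {y : E} (hy : IsAlgebraic R y) : y ∈ acl B := by
  let L := algebraicClosure (Subfield.closure B) E
  let _ : Algebra R L := ((algebraMap R E).codRestrict L hB).toAlgebra
  have : IsScalarTower R L E := IsScalarTower.of_algebraMap_eq fun r => rfl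
  have hinj' : Function.Injective (algebraMap R L) := by
    have h : Function.Injective (algebraMap L E ∘ algebraMap R L) := hinj
    exact h.of_comp
  exact mem_acl.2 ((hy.extendScalars hinj' : IsAlgebraic L y).restrictScalars (Subfield.closure B))

theorem acl_le {A B : Set E} (h : A ⊆ acl B) : acl A ≤ acl B := fun _ hy =>
  mem_acl_of_isAlgebraic (R := Subfield.closure A) (algebraMap (Subfield.closure A) E).injective
    (fun r => Subfield.closure_le.2 h r.2) (mem_acl.1 hy)

theorem acl_mono {A B : Set E} (h : A ⊆ B) : acl A ≤ acl B := acl_le (h.trans (subset_acl B))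

theorem mem_acl_range_algebraMap {R : Type*} [CommRing R] [IsDomain R] [Algebra R E]
    (hinj : Function.Injective (algebraMap R E)) {y : E} :
    y ∈ acl (Set.range (algebraMap R E)) ↔ IsAlgebraic R y := by
  refine ⟨fun hy => ?_, mem_acl_of_isAlgebraic hinj fun r =>
    subset_acl (Set.range (algebraMap R E)) (Set.mem_range_self r)⟩
  let L : Subfield E :=
    { Subalgebra.algebraicClosure R E with
      neg_mem' := fun {x} (hx : IsAlgebraic R x) => hx.neg
      inv_mem' := fun x (hx : IsAlgebraic R x) => hx.inv }
  have hL : Subfield.closure (Set.range (algebraMap R E)) ≤ L :=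
    Subfield.closure_le.2 (by
      rintro _ ⟨r, rfl⟩
      exact isAlgebraic_algebraMap r)
  let _ : Algebra R (Subfield.closure (Set.range (algebraMap R E))) :=
    ((algebraMap R E).codRestrict _ fun r =>
      Subfield.subset_closure (Set.mem_range_self r)).toAlgebra
  have : IsScalarTower R (Subfield.closure (Set.range (algebraMap R E))) E :=
    IsScalarTower.of_algebraMap_eq fun r => rfl
  have : Algebra.IsAlgebraic R (Subfield.closure (Set.range (algebraMap R E))) :=
    ⟨fun x => (isAlgebraic_algebraMap_iff
      (algebraMap (Subfield.closure (Set.range (algebraMap R E))) E).injective).1 (hL x.2)⟩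
  exact (mem_acl.1 hy).restrictScalars R

/-- Algebraic independence with respect to polynomials with coefficients in a set. -/
def PolyIndependent {ι : Type*} (A : Set E) (x : ι → E) : Prop :=
  ∀ p : MvPolynomial ι E, (∀ m, p.coeff m ∈ A) → MvPolynomial.eval x p = 0 → p = 0

theorem PolyIndependent.mono {ι : Type*} {A B : Set E} {x : ι → E} (h : PolyIndependent B x)
    (hAB : A ⊆ B) : PolyIndependent A x := fun p hp => h p fun m => hAB (hp m)

theorem algebraicIndependent_iff_polyIndependent {R ι : Type*} [CommRing R] [Algebra R E]
    (hinj : Function.Injective (algebraMap R E)) {x : ι → E} :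
    AlgebraicIndependent R x ↔ PolyIndependent (Set.range (algebraMap R E)) x := by
  rw [AlgebraicIndependent, injective_iff_map_eq_zero]
  constructor
  · intro h p hp h0
    obtain ⟨q, rfl⟩ := (MvPolynomial.mem_range_map_iff_coeffs_subset (f := algebraMap R E)).2 (by
      intro c hc
      obtain ⟨m, -, rfl⟩ := MvPolynomial.mem_coeffs_iff.1 hc
      exact hp m)
    rw [h q (by rwa [MvPolynomial.aeval_def, ← MvPolynomial.eval_map]), map_zero]
  · intro h q h0
    have := h (MvPolynomial.map (algebraMap R E) q) (fun m => by simp [MvPolynomial.coeff_map])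
      (by rwa [MvPolynomial.eval_map, ← MvPolynomial.aeval_def])
    exact MvPolynomial.map_injective _ hinj (by rw [this, map_zero])

theorem algebraicIndependent_iff_polyIndependent_acl {R ι : Type*} [CommRing R] [IsDomain R]
    [Algebra R E] (hinj : Function.Injective (algebraMap R E)) {x : ι → E} :
    AlgebraicIndependent R x ↔ PolyIndependent (acl (Set.range (algebraMap R E)) : Set E) x := by
  constructor
  · intro h
    have h1 := (algebraicIndependent_iff_polyIndependent
      (R := Subalgebra.algebraicClosure R E) Subtype.val_injective).1 h.subalgebraAlgebraicClosure
    refine h1.mono fun y hy => ?_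
    exact ⟨⟨y, (mem_acl_range_algebraMap hinj).1 hy⟩, rfl⟩
  · intro h
    exact (algebraicIndependent_iff_polyIndependent hinj).2 (h.mono (subset_acl _))

theorem algebraicIndependent_acl_iff {ι : Type*} {A : Set E} {x : ι → E} :
    AlgebraicIndependent (acl A) x ↔ PolyIndependent (acl A : Set E) x := by
  rw [algebraicIndependent_iff_polyIndependent (algebraMap (acl A) E).injective]
  congr!
  exact Subtype.range_coe

theorem polyIndependent_sumElim {ι κ : Type*} {A : Set E} {x : ι → E} {y : κ → E} :
    PolyIndependent (acl A : Set E) (Sum.elim y x) ↔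
      PolyIndependent (acl A : Set E) x ∧
        PolyIndependent (acl (A ∪ Set.range x) : Set E) y := by
  rw [← algebraicIndependent_acl_iff, AlgebraicIndependent.sumElim_iff,
    algebraicIndependent_acl_iff, algebraicIndependent_iff_polyIndependent_acl
      (R := Algebra.adjoin (acl A) (Set.range x)) Subtype.val_injective]
  have : acl (Set.range (algebraMap (Algebra.adjoin (acl A) (Set.range x)) E)) =
      acl (A ∪ Set.range x) := by
    apply le_antisymm
    · refine acl_le ?_
      rintro _ ⟨⟨r, hr⟩, rfl⟩
      change r ∈ acl (A ∪ Set.range x)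
      induction hr using Algebra.adjoin_induction with
      | mem z hz => exact subset_acl _ (Or.inr hz)
      | algebraMap r => exact acl_mono Set.subset_union_left r.2
      | add a b _ _ ha hb => exact add_mem ha hb
      | mul a b _ _ ha hb => exact mul_mem ha hb
    · refine acl_le (Set.union_subset ?_ ?_)
      · intro a ha
        exact subset_acl _ ⟨algebraMap (acl A) _ ⟨a, subset_acl A ha⟩, rfl⟩
      · intro a ha
        exact subset_acl _ ⟨⟨a, Algebra.subset_adjoin ha⟩, rfl⟩
  rw [this]

theorem PolyIndependent.comp {ι κ : Type*} {A : Set E} {x : ι → E}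
    (h : PolyIndependent (acl A : Set E) x) (f : κ → ι) (hf : Function.Injective f) :
    PolyIndependent (acl A : Set E) (x ∘ f) :=
  algebraicIndependent_acl_iff.1 ((algebraicIndependent_acl_iff.2 h).comp f hf)

theorem polyIndependent_unit {A : Set E} {x : Unit → E} :
    PolyIndependent (acl A : Set E) x ↔ x () ∉ acl A := by
  rw [← algebraicIndependent_acl_iff, algebraicIndependent_unique_type_iff]
  rw [Transcendental, not_iff_not]
  have := mem_acl_range_algebraMap (R := acl A) (algebraMap (acl A) E).injective (y := x ())
  change IsAlgebraic _ (x ()) ↔ _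
  rw [← this]
  have h : acl (Set.range (algebraMap (acl A) E)) = acl A :=
    le_antisymm (acl_le (by rintro _ ⟨r, rfl⟩; exact r.2))
      (acl_le fun a ha => subset_acl _ ⟨⟨a, subset_acl A ha⟩, rfl⟩)
  rw [h]

end AlgebraicClosureOperator

section SeriesInVariables

variable {σ : Type*} [Fintype σ]

/-- The subalgebra of convergent series in which only variables from `s` occur. -/
def seriesIn (s : Set σ) : Subalgebra ℚ (convergentSeries σ) where
  carrier := {c | ∀ μ : σ →₀ ℕ, MvPowerSeries.coeff μ c.1 ≠ 0 → ∀ j ∉ s, μ j = 0}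
  mul_mem' := by
    classical
    intro c d hc hd μ hμ j hj
    rw [Subalgebra.coe_mul, MvPowerSeries.coeff_mul] at hμ
    obtain ⟨p, hp, hp0⟩ := Finset.exists_ne_zero_of_sum_ne_zero hμ
    rw [Finset.HasAntidiagonal.mem_antidiagonal] at hp
    rw [← hp, Finsupp.add_apply, hc _ (left_ne_zero_of_mul hp0) j hj,
      hd _ (right_ne_zero_of_mul hp0) j hj]
  add_mem' := by
    intro c d hc hd μ hμ j hj
    by_cases h : MvPowerSeries.coeff μ c.1 = 0
    · refine hd μ (fun h' => hμ ?_) j hj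
      rw [Subalgebra.coe_add, map_add, h, h', add_zero]
    · exact hc μ h j hj
  algebraMap_mem' := by
    classical
    intro q μ hμ j _
    have h : ((algebraMap ℚ (convergentSeries σ) q : convergentSeries σ) : MvPowerSeries σ ℚ) =
      MvPowerSeries.C q := rfl
    rw [h, MvPowerSeries.coeff_C] at hμ
    by_cases h0 : μ = 0
    · rw [h0]; rfl
    · exact absurd (if_neg h0) hμ

theorem seriesIn_mono {s t : Set σ} (h : s ⊆ t) : seriesIn s ≤ seriesIn t :=
  fun _ hc μ hμ j hj => hc μ hμ j fun hs => hj (h hs)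

theorem X_mem_seriesIn (i : σ) :
    (⟨_, X_mem_convergentSeries i⟩ : convergentSeries σ) ∈ seriesIn ({i} : Set σ) := by
  classical
  intro μ hμ j hj
  change MvPowerSeries.coeff μ (MvPowerSeries.X i) ≠ 0 at hμ
  rw [MvPowerSeries.coeff_X] at hμ
  have : μ = Finsupp.single i 1 := by
    by_contra h
    exact hμ (if_neg h)
  rw [this, Finsupp.single_eq_of_ne]
  exact hj

theorem coeff_mul_of_mem_seriesIn {s : Set σ} {c d : convergentSeries σ} (hc : c ∈ seriesIn sᶜ)
    (hd : d ∈ seriesIn s) {μ ν : σ →₀ ℕ} (hμ : ∀ j ∈ s, μ j = 0) (hν : ∀ j ∉ s, ν j = 0) :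
    MvPowerSeries.coeff (μ + ν) (c * d).1 =
      MvPowerSeries.coeff μ c.1 * MvPowerSeries.coeff ν d.1 := by
  classical
  rw [Subalgebra.coe_mul, MvPowerSeries.coeff_mul, Finset.sum_eq_single (μ, ν)]
  · rintro ⟨p, q⟩ hpq hne
    rw [Finset.HasAntidiagonal.mem_antidiagonal] at hpq
    by_contra h
    have hp := hc _ (left_ne_zero_of_mul h)
    have hq := hd _ (right_ne_zero_of_mul h)
    have hpμ : p = μ := by
      ext j
      by_cases hj : j ∈ s
      · rw [hμ j hj]; exact hp j fun h => h hj
      · have := DFunLike.congr_fun hpq j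
        simpa [hν j hj, hq j hj] using this
    refine hne ?_
    have hqν : q = ν := by simpa [hpμ] using hpq
    rw [hpμ, hqν]
  · intro h
    rw [Finset.HasAntidiagonal.mem_antidiagonal] at h
    exact (h rfl).elim

/-- Algebraically independent series in some of the variables remain independent over series in the
other variables. -/
theorem algebraicIndependent_seriesIn {κ : Type*} {s : Set σ} {h : κ → convergentSeries σ}
    (hs : ∀ k, h k ∈ seriesIn s) (hh : AlgebraicIndependent ℚ h) :
    AlgebraicIndependent (seriesIn (sᶜ : Set σ)) h := by
  classical
  rw [AlgebraicIndependent, injective_iff_map_eq_zero] at hh ⊢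
  intro P hP
  have hmon : ∀ m : κ →₀ ℕ, (m.prod fun i k => h i ^ k) ∈ seriesIn s := fun m =>
    prod_mem fun i _ => pow_mem (hs i) _
  have hP' : ∑ m ∈ P.support, ((P.coeff m : seriesIn (sᶜ : Set σ)) : convergentSeries σ) *
      (m.prod fun i k => h i ^ k) = 0 := by
    rw [← hP, MvPolynomial.aeval_def, MvPolynomial.eval₂_eq]
    rfl
  ext m : 1
  rw [MvPolynomial.coeff_zero]
  refine Subtype.ext (Subtype.ext (MvPowerSeries.ext fun μ => ?_))
  rw [ZeroMemClass.coe_zero, ZeroMemClass.coe_zero, map_zero]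
  by_contra hne
  have hμ : ∀ j ∈ s, μ j = 0 := fun j hj => (P.coeff m).2 μ hne j fun h => h hj
  let Q : MvPolynomial κ ℚ := ∑ m ∈ P.support,
    MvPolynomial.monomial m (MvPowerSeries.coeff μ (P.coeff m).1.1)
  have hQ : Q = 0 := by
    refine hh Q (Subtype.ext (MvPowerSeries.ext fun ν => ?_))
    simp only [Q, map_sum, MvPolynomial.aeval_monomial]
    rw [ZeroMemClass.coe_zero, map_zero, AddSubmonoidClass.coe_finsetSum, map_sum]
    have hterm : ∀ m : κ →₀ ℕ, MvPowerSeries.coeff ν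
        ((algebraMap ℚ (convergentSeries σ) (MvPowerSeries.coeff μ (P.coeff m).1.1) *
          m.prod fun i k => h i ^ k : convergentSeries σ) : MvPowerSeries σ ℚ) =
        MvPowerSeries.coeff μ (P.coeff m).1.1 *
          MvPowerSeries.coeff ν (m.prod fun i k => h i ^ k).1 := fun m => by
      rw [← Algebra.smul_def, Subalgebra.coe_smul, MvPowerSeries.coeff_smul]
    simp only [hterm]
    by_cases hν : ∀ j ∉ s, ν j = 0
    · have := congrArg (fun c : convergentSeries σ => MvPowerSeries.coeff (μ + ν) c.1) hP'
      simp only [AddSubmonoidClass.coe_finsetSum, map_sum, ZeroMemClass.coe_zero, map_zero] at this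
      rw [← this]
      exact Finset.sum_congr rfl fun m _ =>
        (coeff_mul_of_mem_seriesIn (P.coeff m).2 (hmon m) hμ hν).symm
    · push Not at hν
      obtain ⟨j, hj, hj0⟩ := hν
      refine Finset.sum_eq_zero fun m _ => ?_
      by_contra h
      exact hj0 (hmon m ν (right_ne_zero_of_mul h) j hj)
  have := congrArg (MvPolynomial.coeff m) hQ
  simp only [Q, MvPolynomial.coeff_sum, MvPolynomial.coeff_monomial, MvPolynomial.coeff_zero,
    Finset.sum_ite_eq', MvPolynomial.mem_support_iff] at this
  rw [if_pos] at this
  · exact hne this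
  · intro h0
    rw [h0] at hne
    exact hne (by simp)

theorem transcendental_X_convergentSeries (i : σ) :
    Transcendental ℚ (⟨_, X_mem_convergentSeries i⟩ : convergentSeries σ) := by
  intro h
  have h1 : IsAlgebraic ℚ (MvPowerSeries.X i : MvPowerSeries σ ℚ) :=
    (isAlgebraic_algHom_iff (convergentSeries σ).val Subtype.val_injective).2 h
  have h2 := (isAlgebraic_algHom_iff (MvPolynomial.coeToMvPowerSeries.algHom (σ := σ) (R := ℚ) ℚ)
    (a := MvPolynomial.X i) (fun a b hab => MvPolynomial.coe_injective σ ℚ (by simpa using hab))).1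
      (by simpa using h1)
  exact MvPolynomial.transcendental_X ℚ i h2

end SeriesInVariables

section IndependentValues

theorem exists_polyIndependent_basis {E : Type*} [Field E] {A s t : Set E} (hst : s ⊆ t)
    (hs : PolyIndependent (acl A : Set E) ((↑) : s → E)) :
    ∃ u, s ⊆ u ∧ u ⊆ t ∧ PolyIndependent (acl A : Set E) ((↑) : u → E) ∧
      t ⊆ acl (A ∪ u) := by
  classical
  obtain ⟨u, hsu, hu⟩ := exists_maximal_algebraicIndependent (R := acl A) s t hst
    (algebraicIndependent_acl_iff.2 hs)
  have hui : PolyIndependent (acl A : Set E) ((↑) : u → E) :=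
    algebraicIndependent_acl_iff.1 hu.prop.1
  refine ⟨u, hsu, hu.prop.2, hui, fun y hy => ?_⟩
  by_contra hyu
  have hyu' : y ∉ u := fun h => hyu (subset_acl _ (Or.inr h))
  have h1 : PolyIndependent (acl A : Set E) (Sum.elim (fun _ : Unit => y) ((↑) : u → E)) := by
    refine polyIndependent_sumElim.2 ⟨hui, polyIndependent_unit.2 ?_⟩
    rwa [Subtype.range_coe]
  let f : ↥(insert y u) → Unit ⊕ u := fun w =>
    if h : (w : E) ∈ u then Sum.inr ⟨w, h⟩ else Sum.inl ()
  have hf : Sum.elim (fun _ : Unit => y) ((↑) : u → E) ∘ f = (↑) := by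
    funext w
    by_cases h : (w : E) ∈ u
    · simp [f, h]
    · have := w.2.resolve_right h
      simp only [f, Function.comp_apply, dif_neg h, Sum.elim_inl]
      exact this.symm
  have hinj : Function.Injective f := by
    refine Function.Injective.of_comp (f := Sum.elim (fun _ : Unit => y) ((↑) : u → E)) ?_
    rw [hf]
    exact Subtype.val_injective
  have h2 := h1.comp f hinj
  rw [hf] at h2
  exact hyu' (hu.le_of_ge ⟨algebraicIndependent_acl_iff.2 h2, Set.insert_subset hy hu.prop.2⟩
    (Set.subset_insert y u) (Set.mem_insert y u))

namespace EvaluationSetup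

variable {σ : Type*} [Fintype σ] {E : Type*} [Field E] [LinearOrder E] [IsStrictOrderedRing E]
  (S : EvaluationSetup σ E)

theorem polyIndependent_of_seriesIn {s : Set σ} {u : Set E}
    (hu : u ⊆ S.ev '' (seriesIn s : Set (convergentSeries σ)))
    (hind : PolyIndependent (acl (∅ : Set E) : Set E) ((↑) : u → E)) :
    PolyIndependent (acl (S.ev '' (seriesIn (sᶜ : Set σ) : Set (convergentSeries σ))) : Set E)
      ((↑) : u → E) := by
  choose h hmem hval using fun w : u => hu w.2
  have hu' : ((↑) : u → E) = S.ev ∘ h := funext fun w => (hval w).symm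
  have h1 : AlgebraicIndependent ℚ ((↑) : u → E) := by
    rw [algebraicIndependent_iff_polyIndependent_acl (algebraMap ℚ E).injective]
    refine hind.mono (acl_le ?_)
    rintro _ ⟨q, rfl⟩
    exact SubfieldClass.ratCast_mem (acl (∅ : Set E)) q
  have h2 : AlgebraicIndependent ℚ h := by
    rw [← AlgHom.algebraicIndependent_iff S.ev.toRatAlgHom S.ev_injective]
    rw [hu'] at h1
    exact h1
  have h3 := algebraicIndependent_seriesIn hmem h2
  let _ : Algebra (seriesIn (sᶜ : Set σ)) E :=
    (S.ev.comp (seriesIn (sᶜ : Set σ)).subtype).toAlgebra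
  let φ : convergentSeries σ →ₐ[seriesIn (sᶜ : Set σ)] E := { S.ev with commutes' := fun _ => rfl }
  have h4 := h3.map' (f := φ) S.ev_injective
  have hinj : Function.Injective (algebraMap (seriesIn (sᶜ : Set σ)) E) :=
    S.ev_injective.comp Subtype.val_injective
  have : IsDomain (seriesIn (sᶜ : Set σ)) := hinj.isDomain (algebraMap (seriesIn (sᶜ : Set σ)) E)
  rw [algebraicIndependent_iff_polyIndependent_acl hinj] at h4
  have hr : Set.range (algebraMap (seriesIn (sᶜ : Set σ)) E) =
      S.ev '' (seriesIn (sᶜ : Set σ) : Set (convergentSeries σ)) := by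
    ext y
    constructor
    · rintro ⟨c, rfl⟩; exact ⟨c, c.2, rfl⟩
    · rintro ⟨c, hc, rfl⟩; exact ⟨⟨c, hc⟩, rfl⟩
  rw [hr] at h4
  rw [hu']
  exact h4

/-- The field elements that are combinations of values of series in the `i`-th variable, with
coefficients in the field of bounded rationals. -/
def mixedValues (i : σ) : Submodule S.boundedRationals E :=
  Submodule.span S.boundedRationals (S.ev '' (seriesIn ({i} : Set σ) : Set (convergentSeries σ)))

theorem mixedValues_subset {i : σ} {L : Subfield E} (hL : S.boundedRationals ≤ L)
    (hev : S.ev '' (seriesIn ({i} : Set σ) : Set (convergentSeries σ)) ⊆ L) {x : E}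
    (hx : x ∈ S.mixedValues i) : x ∈ L := by
  induction hx using Submodule.span_induction with
  | mem y hy => exact hev hy
  | zero => exact zero_mem L
  | add a b _ _ ha hb => exact add_mem ha hb
  | smul c a _ ha => exact mul_mem (hL c.2) ha

theorem notMem_acl_mixedValues {i : σ} {x : E} (hx : x ∈ S.mixedValues i)
    (hxi : x ∉ acl (S.boundedRationals : Set E)) {Y : Set E}
    (hY : ∀ y ∈ Y, ∃ j ≠ i, y ∈ S.mixedValues j) : x ∉ acl Y := by
  classical
  intro hxY
  set Z : convergentSeries σ := ⟨_, X_mem_convergentSeries i⟩ with hZ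
  set R₁ : Set E := S.ev '' (seriesIn ({i}ᶜ : Set σ) : Set (convergentSeries σ)) with hR₁
  have hz_base : S.ev Z ∈ S.base := by
    rw [S.ev_X]
    exact inv_mem (S.B_mem_base i)
  have hz : S.ev Z ∈ S.boundedRationals := S.base_le_boundedRationals hz_base
  have hsing : PolyIndependent (acl (∅ : Set E) : Set E) ((↑) : ({S.ev Z} : Set E) → E) := by
    have h : PolyIndependent (acl (∅ : Set E) : Set E) (fun _ : Unit => S.ev Z) := by
      rw [polyIndependent_unit]
      intro h
      have h' : S.ev Z ∈ acl (Set.range (algebraMap ℚ E)) := acl_mono (Set.empty_subset _) h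
      rw [mem_acl_range_algebraMap (algebraMap ℚ E).injective] at h'
      exact transcendental_X_convergentSeries i
        ((isAlgebraic_algHom_iff S.ev.toRatAlgHom S.ev_injective).1 h')
    have h2 := h.comp (fun _ : ({S.ev Z} : Set E) => ()) (fun a b _ => Subsingleton.elim a b)
    convert h2 using 1
    funext w
    exact w.2
  obtain ⟨u, hzu, hut, hui, htu⟩ := exists_polyIndependent_basis
    (t := S.ev '' (seriesIn ({i} : Set σ) : Set (convergentSeries σ)))
    (Set.singleton_subset_iff.2 ⟨Z, X_mem_seriesIn i, rfl⟩) hsing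
  have hzu' : S.ev Z ∈ u := hzu rfl
  obtain ⟨t, -, htH, hti, hHt⟩ := exists_polyIndependent_basis (A := (S.base : Set E)) (s := ∅)
    (t := (S.boundedRationals : Set E)) (Set.empty_subset _) (by
      rw [← algebraicIndependent_acl_iff]
      exact algebraicIndependent_empty_type_iff.2 Subtype.val_injective)
  have hbase : acl (Set.range (algebraMap S.base E)) = acl (S.base : Set E) := by
    congr 1
    exact Subtype.range_coe
  have hvalues : acl (Set.range (algebraMap S.values E)) = acl (S.values : Set E) := by
    congr 1
    exact Subtype.range_coe
  have htv : PolyIndependent (acl (S.values : Set E) : Set E) ((↑) : t → E) := by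
    rw [← hbase, ← algebraicIndependent_iff_polyIndependent_acl (algebraMap S.base E).injective]
      at hti
    rw [← hvalues, ← algebraicIndependent_iff_polyIndependent_acl (algebraMap S.values E).injective]
    exact S.algebraicIndependent_values (fun w => htH w.2) hti
  have htu' : PolyIndependent (acl R₁ : Set E) (Sum.elim ((↑) : t → E) ((↑) : u → E)) := by
    refine polyIndependent_sumElim.2 ⟨S.polyIndependent_of_seriesIn hut hui, htv.mono ?_⟩
    refine acl_mono (Set.union_subset ?_ ?_)
    · rintro _ ⟨c, -, rfl⟩
      exact S.ev_mem_values c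
    · rintro _ ⟨w, rfl⟩
      obtain ⟨c, -, hc⟩ := hut w.2
      rw [← hc]
      exact S.ev_mem_values c
  let b : (u \ {S.ev Z} : Set E) → E := (↑)
  let z : Unit → E := fun _ => S.ev Z
  have hbt : PolyIndependent (acl R₁ : Set E) (Sum.elim b (Sum.elim ((↑) : t → E) z)) := by
    let f : (u \ {S.ev Z} : Set E) ⊕ (t ⊕ Unit) → t ⊕ u :=
      Sum.elim (fun w => Sum.inr ⟨w, w.2.1⟩) (Sum.elim Sum.inl fun _ => Sum.inr ⟨S.ev Z, hzu'⟩)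
    have hf : Function.Injective f := by
      rintro (⟨w, hw⟩ | w | w) (⟨w', hw'⟩ | w' | w') h
      · simpa [f] using h
      · simp [f] at h
      · exact absurd (by simpa [f] using h) hw.2
      · simp [f] at h
      · simpa [f] using h
      · simp [f] at h
      · exact absurd (by simpa [f] using h.symm) hw'.2
      · simp [f] at h
      · rfl
    convert htu'.comp f hf using 1
    funext w
    rcases w with w | w | w <;> rfl
  have hbL := (polyIndependent_sumElim.1 hbt).2
  set L := acl (R₁ ∪ Set.range (Sum.elim ((↑) : t → E) z)) with hL
  have hR₁L : R₁ ⊆ L := Set.subset_union_left.trans (subset_acl _)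
  have hzL : S.ev Z ∈ L := subset_acl _ (Or.inr ⟨Sum.inr (), rfl⟩)
  have hbaseL : S.base ≤ L := by
    refine Subfield.closure_le.2 ?_
    rintro _ ⟨j, rfl⟩
    rw [← inv_inv (S.B j), ← S.ev_X]
    refine inv_mem ?_
    by_cases hj : j = i
    · subst hj
      exact hzL
    · exact hR₁L ⟨_, seriesIn_mono (Set.singleton_subset_iff.2 hj) (X_mem_seriesIn j), rfl⟩
  have hHL : S.boundedRationals ≤ L := by
    intro y hy
    refine acl_le (Set.union_subset hbaseL ?_) (hHt hy)
    intro w hw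
    exact subset_acl _ (Or.inr ⟨Sum.inl ⟨w, hw⟩, rfl⟩)
  have hxL : x ∈ L := by
    refine acl_le (fun y hy => ?_) hxY
    obtain ⟨j, hj, hyj⟩ := hY y hy
    refine S.mixedValues_subset hHL ?_ hyj
    refine (Set.image_mono ?_).trans hR₁L
    exact seriesIn_mono (Set.singleton_subset_iff.2 hj)
  have hbx : PolyIndependent (acl (S.boundedRationals : Set E) : Set E)
      (Sum.elim b fun _ : Unit => x) := by
    refine polyIndependent_sumElim.2 ⟨polyIndependent_unit.2 hxi, hbL.mono (acl_le ?_)⟩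
    refine Set.union_subset hHL ?_
    rintro _ ⟨-, rfl⟩
    exact hxL
  have hxb : PolyIndependent (acl (S.boundedRationals : Set E) : Set E)
      (Sum.elim (fun _ : Unit => x) b) := by
    convert hbx.comp Sum.swap Sum.swap_leftInverse.injective using 1
    funext w
    rcases w with w | w <;> rfl
  refine polyIndependent_unit.1 (polyIndependent_sumElim.1 hxb).2 ?_
  refine S.mixedValues_subset (fun y hy => subset_acl _ (Or.inl hy)) (fun y hy => ?_) hx
  refine acl_le ?_ (htu hy)
  rw [Set.empty_union]
  intro w hw
  by_cases hwz : w = S.ev Z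
  · rw [hwz]
    exact subset_acl _ (Or.inl hz)
  · exact subset_acl _ (Or.inr ⟨⟨w, hw, hwz⟩, rfl⟩)

/-- Mixed values in different variables are algebraically independent as soon as none of them is
algebraic over the bounded rationals. -/
theorem algebraicIndependent_mixedValues {x : σ → E} (hx : ∀ i, x i ∈ S.mixedValues i)
    (hxi : ∀ i, x i ∉ acl (S.boundedRationals : Set E)) : AlgebraicIndependent ℚ x := by
  refine algebraicIndependent_of_finite_type' (algebraMap ℚ E).injective fun t _ _ i hi hal => ?_
  refine S.notMem_acl_mixedValues (hx i) (hxi i) (Y := x '' t) ?_ ?_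
  · rintro _ ⟨j, hj, rfl⟩
    exact ⟨j, fun h => hi (h ▸ hj), hx j⟩
  · refine mem_acl_of_isAlgebraic Subtype.val_injective (fun r => ?_) hal
    obtain ⟨r, hr⟩ := r
    change r ∈ acl (x '' t)
    induction hr using Algebra.adjoin_induction with
    | mem z hz => exact subset_acl _ hz
    | algebraMap r => exact SubfieldClass.ratCast_mem _ r
    | add a b _ _ ha hb => exact add_mem ha hb
    | mul a b _ _ ha hb => exact mul_mem ha hb

end EvaluationSetup

end IndependentValues

section DerivationArgument

open scoped TensorProduct

theorem exists_section_extending {K M A : Type*} [Field K] [CharZero K] [Field M] [Algebra K M]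
    [CommRing A] (φ : K →+* A) (π : A →+* M) (hπ : Function.Surjective π)
    (hker : IsNilpotent (RingHom.ker π)) (h : ∀ x, π (φ x) = algebraMap K M x) :
    ∃ s : M →+* A, (∀ y, π (s y) = y) ∧ ∀ x, s (algebraMap K M x) = φ x := by
  let _ : Algebra K A := φ.toAlgebra
  let π' : A →ₐ[K] M := { π with commutes' := h }
  obtain ⟨b, hb⟩ := exists_isTranscendenceBasis K M
  have := hb.isAlgebraic_field
  have : Algebra.FormallySmooth K M :=
    Algebra.FormallySmooth.of_algebraicIndependent_of_isSeparable hb.1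
  let s := Algebra.FormallySmooth.liftOfSurjective (AlgHom.id K M) π' hπ hker
  exact ⟨s, fun y => Algebra.FormallySmooth.liftOfSurjective_apply (AlgHom.id K M) π' hπ hker y,
    fun x => s.commutes x⟩

theorem isNilpotent_ker_fst (M : Type*) [Field M] :
    IsNilpotent (RingHom.ker (TrivSqZeroExt.fstHom M M M : DualNumber M →+* M)) :=
  ⟨2, TrivSqZeroExt.kerIdeal_sq M M⟩

/-- In characteristic zero, a transcendental element has nonzero derivative for some derivation. -/
theorem exists_dualNumber_section {F M : Type*} [Field F] [CharZero F] [Field M] [Algebra F M]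
    {u : M}
    (hu : Transcendental F u) : ∃ s : M →ₐ[F] DualNumber M,
      (∀ y, TrivSqZeroExt.fst (s y) = y) ∧ TrivSqZeroExt.snd (s u) = 1 := by
  let g : Polynomial F →ₐ[F] DualNumber M :=
    Polynomial.aeval (TrivSqZeroExt.inl u + DualNumber.eps)
  have hg : ∀ p, TrivSqZeroExt.fst (g p) = Polynomial.aeval u p := by
    intro p
    have : (TrivSqZeroExt.fstHom F M M).comp g = Polynomial.aeval u := by
      ext
      simp [g]
    exact DFunLike.congr_fun this p
  let e := RatFunc.algEquivOfTranscendental u hu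
  let φ₀ : RatFunc F →+* DualNumber M :=
    IsLocalization.lift (M := nonZeroDivisors (Polynomial F)) (g := (g : Polynomial F →+* DualNumber M))
      (fun y => by
        rw [TrivSqZeroExt.isUnit_iff_isUnit_fst, isUnit_iff_ne_zero]
        change TrivSqZeroExt.fst (g y) ≠ 0
        rw [hg]
        exact fun h => nonZeroDivisors.ne_zero y.2 ((transcendental_iff.1 hu) _ h))
  have hφ₀ : ∀ p : Polynomial F, φ₀ (algebraMap _ _ p) = g p := fun p => IsLocalization.lift_eq _ p
  let φ : IntermediateField.adjoin F {u} →+* DualNumber M := φ₀.comp (e.symm : _ →+* RatFunc F)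
  have hφ : ∀ p : Polynomial F, φ (e (algebraMap _ _ p)) = g p := fun p => by
    simp [φ, hφ₀]
  have hφfst : ∀ x, TrivSqZeroExt.fstHom M M M (φ x) =
      algebraMap (IntermediateField.adjoin F {u}) M x := by
    intro x
    have h : (TrivSqZeroExt.fstHom M M M : DualNumber M →+* M).comp
        (φ.comp (e : RatFunc F →+* _)) = (algebraMap (IntermediateField.adjoin F {u}) M).comp
          (e : RatFunc F →+* _) := by
      refine IsLocalization.ringHom_ext (nonZeroDivisors (Polynomial F)) ?_
      refine RingHom.ext fun p => ?_
      change TrivSqZeroExt.fst (φ (e (algebraMap _ _ p))) = (e (algebraMap _ _ p) : M)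
      rw [hφ, hg, RatFunc.algEquivOfTranscendental_algebraMap]
      exact (Polynomial.aeval_algebraMap_apply M (IntermediateField.AdjoinSimple.gen F u) p)
    have := DFunLike.congr_fun h (e.symm x)
    simpa using this
  obtain ⟨s, hs, hs'⟩ := exists_section_extending φ
    (TrivSqZeroExt.fstHom M M M : DualNumber M →+* M) (fun y => ⟨TrivSqZeroExt.inl y, rfl⟩)
    (isNilpotent_ker_fst M) hφfst
  have hse : ∀ p : Polynomial F, s (Polynomial.aeval u p) = g p := fun p => by
    rw [← hφ, ← hs', RatFunc.algEquivOfTranscendental_algebraMap]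
    congr 1
    exact Polynomial.aeval_algebraMap_apply M (IntermediateField.AdjoinSimple.gen F u) p
  refine ⟨{ s with commutes' := fun x => ?_ }, hs, ?_⟩
  · have := hse (Polynomial.C x)
    rw [Polynomial.aeval_C] at this
    change s (algebraMap F M x) = _
    rw [this]
    exact g.commutes x
  · have := hse Polynomial.X
    simp only [Polynomial.aeval_X, g] at this
    change TrivSqZeroExt.snd (s u) = 1
    rw [this]
    simp

/-- If an algebraic element lies in the compositum of two linearly disjoint fields `A` and `B`, its
coordinates in `B` with respect to a basis of `A` are algebraic. -/
theorem isAlgebraic_coordinates {F E : Type*} [Field F] [CharZero F] [Field E] [Algebra F E]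
    {A B : IntermediateField F E} {κ : Type*} (e : Module.Basis κ F A)
    (he : LinearIndependent B fun k => (e k : E)) (t : Finset κ) (u : κ → B)
    (hx : IsAlgebraic F (∑ k ∈ t, (e k : E) * u k)) {k : κ} (hk : k ∈ t) : IsAlgebraic F (u k) := by
  by_contra hu
  obtain ⟨s, hs, hs1⟩ := exists_dualNumber_section (u := u k) hu
  have hdis : A.toSubalgebra.LinearDisjoint B.toSubalgebra :=
    Subalgebra.LinearDisjoint.of_basis_left A.toSubalgebra B.toSubalgebra e he
  have hinj := Subalgebra.linearDisjoint_iff_injective.1 hdis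
  have hs2 : ∀ a b, TrivSqZeroExt.snd (s (a * b)) =
      a * TrivSqZeroExt.snd (s b) + b * TrivSqZeroExt.snd (s a) := fun a b => by
    rw [map_mul, TrivSqZeroExt.snd_mul, hs, hs]
    simp [mul_comm]
  let g : B →ₐ[F] DualNumber E :=
    { toFun := fun y => TrivSqZeroExt.inl (y : E) + TrivSqZeroExt.inr ((TrivSqZeroExt.snd (s y) : B) : E)
      map_one' := by ext <;> simp
      map_zero' := by ext <;> simp
      map_add' := fun a b => by ext <;> simp
      map_mul' := fun a b => by ext <;> simp [hs]
      commutes' := fun x => by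
        ext
        · simp
          rfl
        · simp only [AlgHom.commutes, TrivSqZeroExt.snd_add, TrivSqZeroExt.snd_inl,
            TrivSqZeroExt.snd_inr, zero_add, TrivSqZeroExt.algebraMap_eq_inl']
          rfl }
  let f : A →ₐ[F] DualNumber E := (TrivSqZeroExt.inlAlgHom F E E).comp A.val
  let Ψ : A.toSubalgebra ⊗[F] B.toSubalgebra →ₐ[F] DualNumber E :=
    Algebra.TensorProduct.lift f g fun _ _ => Commute.all _ _
  set x : E := ∑ k ∈ t, (e k : E) * u k with hxdef
  let y : A.toSubalgebra ⊗[F] B.toSubalgebra := ∑ k ∈ t, e k ⊗ₜ[F] u k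
  have hy : A.toSubalgebra.mulMap B.toSubalgebra y = x := by
    simp only [y, map_sum, hxdef]
    rfl
  have hp0 : Polynomial.aeval y (minpoly F x) = 0 := by
    apply hinj
    rw [map_zero, ← Polynomial.aeval_algHom_apply, hy, minpoly.aeval]
  set c : E := ∑ k ∈ t, (e k : E) * (TrivSqZeroExt.snd (s (u k)) : B) with hc
  have hΨ : Ψ y = TrivSqZeroExt.inl x + TrivSqZeroExt.inr c := by
    have h1 : ∀ k, Ψ (e k ⊗ₜ[F] u k) = TrivSqZeroExt.inl ((e k : E) * u k) +
        TrivSqZeroExt.inr ((e k : E) * (TrivSqZeroExt.snd (s (u k)) : B)) := fun k => by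
      have : Ψ (e k ⊗ₜ[F] u k) = f (e k) * g (u k) := Algebra.TensorProduct.lift_tmul _ _ _ _ _
      rw [this]
      ext <;> simp [f, g]
    simp only [y, map_sum, h1, hxdef, hc, Finset.sum_add_distrib]
    rw [← TrivSqZeroExt.inl_sum, ← TrivSqZeroExt.inr_sum]
  have h0 : Polynomial.aeval (TrivSqZeroExt.inl x + TrivSqZeroExt.inr c : DualNumber E)
      (minpoly F x) = 0 := by
    rw [← hΨ, Polynomial.aeval_algHom_apply, hp0, map_zero]
  have hinl : ∀ p : Polynomial F, Polynomial.aeval (TrivSqZeroExt.inl x : DualNumber E) p =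
      TrivSqZeroExt.inl (Polynomial.aeval x p) := fun p =>
    Polynomial.aeval_algHom_apply (TrivSqZeroExt.inlAlgHom F E E) x p
  rw [Polynomial.aeval_add_of_sq_eq_zero _ _ _ (by rw [pow_two, TrivSqZeroExt.inr_mul_inr]), hinl,
    hinl, minpoly.aeval] at h0
  have h2 := congrArg TrivSqZeroExt.snd h0
  simp only [TrivSqZeroExt.inl_zero, zero_add, TrivSqZeroExt.inl_mul_inr, TrivSqZeroExt.snd_inr,
    TrivSqZeroExt.snd_zero, smul_eq_mul] at h2
  have hsep : Polynomial.aeval x (Polynomial.derivative (minpoly F x)) ≠ 0 :=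
    (minpoly.irreducible hx.isIntegral).separable.aeval_derivative_ne_zero (minpoly.aeval F x)
  have hc0 : c = 0 := (mul_eq_zero.1 h2).resolve_left hsep
  have h3 := linearIndependent_iff'.1 he t (fun k => TrivSqZeroExt.snd (s (u k))) (by
    rw [← hc0, hc]
    exact Finset.sum_congr rfl fun k _ => mul_comm _ _) k hk
  exact one_ne_zero (hs1.symm.trans h3)

end DerivationArgument

section FiniteValuedSeries

open Polynomial

/-- The series in one variable with finitely many distinct coefficients. -/
def finiteValued : Set (convergentSeries Unit) :=
  {y | (Set.range fun n => PowerSeries.coeff n (y.1 : PowerSeries ℚ)).Finite}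

/-- The variable, as a convergent series. -/
def convergentX : convergentSeries Unit := ⟨_, X_mem_convergentSeries ()⟩

theorem finiteValued_add {y w : convergentSeries Unit} (hy : y ∈ finiteValued)
    (hw : w ∈ finiteValued) : y + w ∈ finiteValued := by
  refine (Set.Finite.image2 (· + ·) hy hw).subset ?_
  rintro _ ⟨n, rfl⟩
  exact ⟨_, ⟨n, rfl⟩, _, ⟨n, rfl⟩, (map_add (PowerSeries.coeff (R := ℚ) n) _ _).symm⟩

theorem finiteValued_smul (a : ℚ) {y : convergentSeries Unit} (hy : y ∈ finiteValued) :
    a • y ∈ finiteValued := by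
  refine (Set.Finite.image (a * ·) hy).subset ?_
  rintro _ ⟨n, rfl⟩
  exact ⟨_, ⟨n, rfl⟩, (PowerSeries.coeff_smul n (y.1 : PowerSeries ℚ) a).symm⟩

theorem finiteValued_X_mul {y : convergentSeries Unit} (hy : y ∈ finiteValued) :
    convergentX * y ∈ finiteValued := by
  refine (Set.Finite.insert 0 hy).subset ?_
  rintro _ ⟨n, rfl⟩
  cases n with
  | zero => exact Or.inl (PowerSeries.coeff_zero_X_mul _)
  | succ n => exact Or.inr ⟨n, (PowerSeries.coeff_succ_X_mul n _).symm⟩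

theorem finiteValued_aeval_mul (p : ℚ[X]) {y : convergentSeries Unit} (hy : y ∈ finiteValued) :
    aeval convergentX p * y ∈ finiteValued := by
  induction p using Polynomial.induction_on generalizing y with
  | C a =>
    rw [aeval_C, ← Algebra.smul_def]
    exact finiteValued_smul a hy
  | add p q hp hq =>
    rw [map_add, add_mul]
    exact finiteValued_add (hp hy) (hq hy)
  | monomial n a h =>
    rw [pow_succ, ← mul_assoc, map_mul, aeval_X, mul_assoc]
    exact h (finiteValued_X_mul hy)

theorem coe_aeval_convergentX (p : ℚ[X]) :
    ((aeval convergentX p : convergentSeries Unit) : PowerSeries ℚ) = p := by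
  have : (convergentSeries Unit).val.comp (aeval convergentX) =
      (Polynomial.coeToPowerSeries.algHom ℚ : ℚ[X] →ₐ[ℚ] PowerSeries ℚ) := by
    refine Polynomial.algHom_ext ?_
    rw [AlgHom.comp_apply, aeval_X, Polynomial.coeToPowerSeries.algHom_apply, Polynomial.coe_X,
      PowerSeries.map_X]
    rfl
  have h := DFunLike.congr_fun this p
  rw [Polynomial.coeToPowerSeries.algHom_apply] at h
  rw [Algebra.algebraMap_self, PowerSeries.map_id] at h
  exact h

end FiniteValuedSeries

namespace EvaluationSetup

open Polynomial

variable {E : Type*} [Field E] [LinearOrder E] [IsStrictOrderedRing E] (S : EvaluationSetup Unit E)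

theorem ev_convergentX : S.ev convergentX = (S.B ())⁻¹ := S.ev_X ()

theorem ev_aeval (p : ℚ[X]) : S.ev (aeval convergentX p) = aeval (S.ev convergentX) p :=
  (Polynomial.aeval_algHom_apply S.ev.toRatAlgHom convergentX p).symm

theorem aeval_mem_base (p : ℚ[X]) : aeval (S.ev convergentX) p ∈ S.base := by
  have hz : S.ev convergentX ∈ S.base := by
    rw [S.ev_convergentX]
    exact inv_mem (S.B_mem_base ())
  induction p using Polynomial.induction_on with
  | C a =>
    rw [aeval_C]
    exact SubfieldClass.ratCast_mem _ a
  | add p q hp hq =>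
    rw [map_add]
    exact add_mem hp hq
  | monomial n a h =>
    rw [pow_succ, ← mul_assoc, map_mul, aeval_X]
    exact mul_mem h hz

theorem base_eq_closure : S.base = Subfield.closure {S.ev convergentX} := by
  apply le_antisymm
  · refine Subfield.closure_le.2 ?_
    rintro _ ⟨⟨⟩, rfl⟩
    rw [← inv_inv (S.B ()), ← S.ev_convergentX]
    exact inv_mem (Subfield.subset_closure rfl)
  · rw [Subfield.closure_le, Set.singleton_subset_iff]
    have := S.aeval_mem_base X
    rwa [aeval_X] at this

theorem exists_eq_div_of_mem_base {x : E} (hx : x ∈ S.base) :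
    ∃ p q : ℚ[X], aeval (S.ev convergentX) q ≠ 0 ∧
      x * aeval (S.ev convergentX) q = aeval (S.ev convergentX) p := by
  have key : ∀ y ∈ Subring.closure {S.ev convergentX},
      ∃ p : ℚ[X], y = aeval (S.ev convergentX) p := by
    intro y hy
    induction hy using Subring.closure_induction with
    | mem y hy => exact ⟨X, by rw [aeval_X]; exact hy⟩
    | zero => exact ⟨0, by simp⟩
    | one => exact ⟨1, by simp⟩
    | add a b _ _ ha hb =>
      obtain ⟨p, rfl⟩ := ha
      obtain ⟨q, rfl⟩ := hb
      exact ⟨p + q, by simp⟩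
    | neg a _ ha =>
      obtain ⟨p, rfl⟩ := ha
      exact ⟨-p, by simp⟩
    | mul a b _ _ ha hb =>
      obtain ⟨p, rfl⟩ := ha
      obtain ⟨q, rfl⟩ := hb
      exact ⟨p * q, by simp⟩
  rw [base_eq_closure, Subfield.mem_closure_iff] at hx
  obtain ⟨a, ha, b, hb, rfl⟩ := hx
  obtain ⟨p, rfl⟩ := key a ha
  obtain ⟨q, rfl⟩ := key b hb
  by_cases h : aeval (S.ev convergentX) q = 0
  · exact ⟨0, 1, by simp, by simp [h]⟩
  · exact ⟨p, q, h, div_mul_cancel₀ _ h⟩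

/-- A value of a finite-valued series which is algebraic over the base field is in the base field. -/
theorem ev_mem_base_of_mem_acl {y : convergentSeries Unit} (hy : y ∈ finiteValued)
    (h : S.ev y ∈ acl (S.base : Set E)) : S.ev y ∈ S.base := by
  let _ : Algebra ℚ[X] E := (aeval (S.ev convergentX) : ℚ[X] →ₐ[ℚ] E).toRingHom.toAlgebra
  let _ : Algebra ℚ[X] (convergentSeries Unit) :=
    (aeval convergentX : ℚ[X] →ₐ[ℚ] convergentSeries Unit).toRingHom.toAlgebra
  have hinj : Function.Injective (algebraMap ℚ[X] E) := by
    rw [injective_iff_map_eq_zero]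
    intro p hp
    have h0 : aeval (S.ev convergentX) p = 0 := hp
    rw [← S.ev_aeval, map_eq_zero_iff _ S.ev_injective] at h0
    exact transcendental_iff.1 (transcendental_X_convergentSeries ()) p h0
  have h1 : IsAlgebraic ℚ[X] (S.ev y) := by
    rw [← mem_acl_range_algebraMap hinj]
    refine acl_le ?_ h
    intro w hw
    obtain ⟨p, q, hq, hw⟩ := S.exists_eq_div_of_mem_base hw
    rw [eq_div_of_mul_eq hq hw]
    exact div_mem (subset_acl _ ⟨p, rfl⟩) (subset_acl _ ⟨q, rfl⟩)
  have h2 : IsAlgebraic ℚ[X] y := (isAlgebraic_algHom_iff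
    ({ S.ev with commutes' := fun p => S.ev_aeval p } : convergentSeries Unit →ₐ[ℚ[X]] E)
      S.ev_injective).1 h1
  have h3 : IsAlgebraic ℚ[X] (y.1 : PowerSeries ℚ) := (isAlgebraic_algHom_iff
    ({ ((convergentSeries Unit).val : convergentSeries Unit →+* PowerSeries ℚ) with
        commutes' := fun p => (coe_aeval_convergentX p).trans (by
          rw [PowerSeries.algebraMap_apply', Algebra.algebraMap_self, PowerSeries.map_id]; rfl) } :
      convergentSeries Unit →ₐ[ℚ[X]] PowerSeries ℚ) Subtype.val_injective).2 h2
  obtain ⟨s, p, hs, hsp⟩ := exists_mul_eq_coe_of_isAlgebraic_of_finite_range h3 hy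
  have h4 : aeval convergentX s * y = aeval convergentX p := by
    refine Subtype.ext ?_
    have := coe_aeval_convergentX p
    rw [← hsp, ← coe_aeval_convergentX s] at this
    exact this.symm
  have h5 := congrArg S.ev h4
  rw [map_mul, S.ev_aeval, S.ev_aeval] at h5
  have hs0 : aeval (S.ev convergentX) s ≠ 0 := fun h => hs (hinj (by rw [map_zero]; exact h))
  rw [eq_div_of_mul_eq hs0 ((mul_comm _ _).trans h5)]
  exact div_mem (S.aeval_mem_base p) (S.aeval_mem_base s)

theorem exists_smul_eq_ev {v : E} (hv : v ∈ Submodule.span S.base (S.ev '' finiteValued)) :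
    ∃ q : ℚ[X], aeval (S.ev convergentX) q ≠ 0 ∧
      ∃ y ∈ finiteValued, aeval (S.ev convergentX) q * v = S.ev y := by
  induction hv using Submodule.span_induction with
  | mem v hv =>
    obtain ⟨y, hy, rfl⟩ := hv
    exact ⟨1, by simp, y, hy, by simp⟩
  | zero => exact ⟨1, by simp, 0, by simp [finiteValued], by simp⟩
  | add a b _ _ ha hb =>
    obtain ⟨q, hq, y, hy, h⟩ := ha
    obtain ⟨q', hq', y', hy', h'⟩ := hb
    refine ⟨q * q', by rw [map_mul]; exact mul_ne_zero hq hq', _, finiteValued_add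
      (finiteValued_aeval_mul q' hy) (finiteValued_aeval_mul q hy'), ?_⟩
    rw [map_add, map_mul S.ev, map_mul S.ev, S.ev_aeval, S.ev_aeval, ← h, ← h', map_mul]
    ring
  | smul c v _ hv =>
    obtain ⟨q, hq, y, hy, h⟩ := hv
    obtain ⟨p, q', hq', hc⟩ := S.exists_eq_div_of_mem_base c.2
    refine ⟨q * q', by rw [map_mul]; exact mul_ne_zero hq hq', _, finiteValued_aeval_mul p hy, ?_⟩
    rw [map_mul, map_mul, S.ev_aeval, ← h, ← hc, Subfield.smul_def, smul_eq_mul]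
    ring

theorem linearIndependent_values (hκ : S.κ = 1) {ι : Type*} {w : ι → E}
    (hw : ∀ g, w g ∈ S.boundedRationals) (hli : LinearIndependent S.base w) :
    LinearIndependent S.values w := by
  rw [linearIndependent_iff_finset_linearIndependent]
  intro s
  rw [linearIndependent_iff_card_le_finrank_span]
  have := S.card_le_mul_finrank (w := w ∘ ((↑) : s → ι)) (fun g => hw g)
    (hli.comp _ Subtype.val_injective)
  simpa [hκ] using this

/-- A combination of values of finite-valued series that is algebraic over `ℚ` is a bounded
rational. -/
theorem mem_boundedRationals_of_isAlgebraic (hκ : S.κ = 1) {x : E}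
    (hx : x ∈ Submodule.span S.boundedRationals (S.ev '' finiteValued)) (halg : IsAlgebraic ℚ x) :
    x ∈ S.boundedRationals := by
  classical
  let A : IntermediateField S.base E :=
    S.boundedRationals.toIntermediateField fun w => S.base_le_boundedRationals w.2
  let B : IntermediateField S.base E :=
    S.values.toIntermediateField fun w => S.base_le_values w.2
  obtain ⟨κ, ⟨e⟩⟩ : ∃ κ : Type _, Nonempty (Module.Basis κ S.base A) :=
    ⟨_, ⟨Module.Basis.ofVectorSpace S.base A⟩⟩
  have he : LinearIndependent B fun k => (e k : E) :=
    S.linearIndependent_values hκ (fun k => (e k).2)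
      (e.linearIndependent.map' A.val.toLinearMap (LinearMap.ker_eq_bot.2 Subtype.val_injective))
  let V := Submodule.span S.base (S.ev '' finiteValued)
  have hVB : ∀ v ∈ V, v ∈ B := by
    intro v hv
    induction hv using Submodule.span_induction with
    | mem v hv =>
      obtain ⟨y, -, rfl⟩ := hv
      exact S.ev_mem_values y
    | zero => exact zero_mem B
    | add a b _ _ ha hb => exact add_mem ha hb
    | smul c v _ hv => exact B.smul_mem hv
  let Φ : (κ →₀ V) →ₗ[S.base] E := Finsupp.lsum S.base fun k =>
    (LinearMap.mulLeft S.base (e k : E)).comp V.subtype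
  have hΦ : ∀ u : κ →₀ V, Φ u = ∑ k ∈ u.support, (e k : E) * u k := fun u => rfl
  have hxΦ : x ∈ LinearMap.range Φ := by
    obtain ⟨n, f, g, rfl⟩ := Submodule.mem_span_set'.1 hx
    refine Submodule.sum_mem _ fun i _ => ?_
    have hgV : (g i : E) ∈ V := Submodule.subset_span (g i).2
    have hf : (f i : E) = ∑ k ∈ (e.repr (f i)).support, (e.repr (f i) k : E) * (e k : E) := by
      have := congrArg (fun w : A => (w : E)) (e.linearCombination_repr (f i))
      rw [Finsupp.linearCombination_apply, Finsupp.sum] at this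
      simp only [AddSubmonoidClass.coe_finsetSum] at this
      exact this.symm
    rw [Subfield.smul_def, smul_eq_mul, hf, Finset.sum_mul]
    refine Submodule.sum_mem _ fun k _ => ?_
    refine ⟨Finsupp.single k (e.repr (f i) k • ⟨g i, hgV⟩), ?_⟩
    rw [Finsupp.lsum_single]
    change (e k : E) * ((e.repr (f i) k : E) * (g i : E)) = _
    ring
  obtain ⟨u, rfl⟩ := hxΦ
  have halg' : IsAlgebraic S.base (Φ u) := halg.extendScalars (algebraMap ℚ S.base).injective
  have hcoord : ∀ k ∈ u.support, (u k : E) ∈ S.boundedRationals := by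
    intro k hk
    have h1 := isAlgebraic_coordinates e he u.support (fun k => ⟨u k, hVB _ (u k).2⟩) halg' hk
    have h2 : IsAlgebraic S.base (u k : E) :=
      (isAlgebraic_algHom_iff B.val Subtype.val_injective).2 h1
    obtain ⟨q, hq, y, hy, h⟩ := S.exists_smul_eq_ev (u k).2
    have h3 : (u k : E) ∈ acl (S.base : Set E) :=
      mem_acl_of_isAlgebraic Subtype.val_injective (fun r => subset_acl _ r.2) h2
    have h4 := S.ev_mem_base_of_mem_acl hy (by
      rw [← h]
      exact mul_mem (subset_acl _ (S.aeval_mem_base q)) h3)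
    rw [eq_div_of_mul_eq hq ((mul_comm _ _).trans h)]
    exact S.base_le_boundedRationals (div_mem h4 (S.aeval_mem_base q))
  rw [hΦ]
  exact sum_mem fun k hk => mul_mem (e k).2 (hcoord k hk)

end EvaluationSetup

section Constants

open Filter Polynomial

namespace Scales

variable {σ : Type*} [Fintype σ] (T : Scales σ)

/-- The germ of a constant sequence. -/
def const : ℝ →+* T.Field := (Germ.coeRingHom _).comp (Pi.constRingHom ℕ ℝ)

theorem const_apply (x : ℝ) : T.const x = ((fun _ => x : ℕ → ℝ) : T.Field) := rfl

theorem eventually_ne_zero_of_coe_ne_zero {f : ℕ → ℝ} (hf : (f : T.Field) ≠ 0) :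
    ∀ᶠ n in T.U, f n ≠ 0 :=
  Ultrafilter.eventually_not.2 fun h => hf (Germ.coe_eq.2 h)

theorem exists_rat_of_const_mem_boundedRationals {x : ℝ}
    (hx : T.const x ∈ T.setup.boundedRationals) : ∃ p : ℚ, x = p := by
  obtain ⟨_, _, ⟨⟨f, rfl⟩, -⟩, ⟨⟨g, rfl⟩, -⟩, hg, h⟩ := hx
  rw [eq_div_iff hg, const_apply, ← Germ.coe_mul] at h
  obtain ⟨n, hn, hn'⟩ := ((T.eventually_ne_zero_of_coe_ne_zero hg).and (Germ.coe_eq.1 h)).exists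
  refine ⟨f n / g n, ?_⟩
  push_cast
  exact eq_div_of_mul_eq hn hn'

theorem isAlgebraic_of_const_mem_acl {x : ℝ}
    (hx : T.const x ∈ acl (T.setup.boundedRationals : Set T.Field)) : IsAlgebraic ℚ x := by
  have hinj : Function.Injective (algebraMap T.intGerms T.Field) := Subtype.val_injective
  have h1 : T.const x ∈ acl (Set.range (algebraMap T.intGerms T.Field)) := by
    refine acl_le ?_ hx
    rintro _ ⟨p, q, ⟨hp, -⟩, ⟨hq, -⟩, -, rfl⟩
    exact div_mem (subset_acl _ ⟨⟨p, hp⟩, rfl⟩) (subset_acl _ ⟨⟨q, hq⟩, rfl⟩)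
  obtain ⟨p, hp0, hp⟩ := (mem_acl_range_algebraMap hinj).1 h1
  choose f hf using fun k => (p.coeff k).2
  have hlead : ((fun n => (f p.natDegree n : ℝ) : ℕ → ℝ) : T.Field) ≠ 0 := by
    rw [← hf]
    exact fun h => leadingCoeff_ne_zero.2 hp0 (Subtype.ext h)
  have hsum : ((fun n => ∑ k ∈ Finset.range (p.natDegree + 1), (f k n : ℝ) * x ^ k : ℕ → ℝ) :
      T.Field) = 0 := by
    rw [← hp, aeval_eq_sum_range]
    have : (fun n => ∑ k ∈ Finset.range (p.natDegree + 1), (f k n : ℝ) * x ^ k : ℕ → ℝ) =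
      ∑ k ∈ Finset.range (p.natDegree + 1), ((fun n => (f k n : ℝ)) * (fun _ => x ^ k)) := by
      ext n
      simp
    rw [this]
    change Germ.coeRingHom _ _ = _
    rw [map_sum]
    refine Finset.sum_congr rfl fun k _ => ?_
    rw [map_mul, Algebra.smul_def, ← map_pow]
    exact congrArg (· * T.const (x ^ k)) (hf k).symm
  obtain ⟨n, hn, hn'⟩ := ((T.eventually_ne_zero_of_coe_ne_zero hlead).and
    (Germ.coe_eq.1 hsum)).exists
  have halg : IsAlgebraic ℤ x := by
    refine ⟨∑ k ∈ Finset.range (p.natDegree + 1), C (f k n) * X ^ k, fun h => hn ?_, ?_⟩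
    · have := congrArg (fun q => coeff q p.natDegree) h
      simpa [finsetSum_coeff, coeff_C_mul, coeff_X_pow] using this
    · simpa using hn'
  exact halg.extendScalars Int.cast_injective

end Scales

end Constants

section BoundedSeries

variable {σ : Type*}

open Classical in
/-- The power series `∑ g m X_i ^ m`. -/
def univariate (i : σ) (g : ℕ → ℕ) : MvPowerSeries σ ℚ := fun μ =>
  if Finsupp.single i (μ i) = μ then (g (μ i) : ℚ) else 0

theorem coeff_univariate_single (i : σ) (g : ℕ → ℕ) (m : ℕ) :
    MvPowerSeries.coeff (Finsupp.single i m) (univariate i g) = g m := by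
  change univariate i g _ = _
  rw [univariate, Finsupp.single_eq_same, if_pos rfl]

theorem coeff_univariate_of_notMem (i : σ) (g : ℕ → ℕ) {μ : σ →₀ ℕ}
    (hμ : μ ∉ Set.range (Finsupp.single i : ℕ → σ →₀ ℕ)) :
    MvPowerSeries.coeff μ (univariate i g) = 0 :=
  if_neg fun h => hμ ⟨_, h⟩

variable [Fintype σ]

theorem monomialValue_single {R : Type*} [CommMonoid R] (z : σ → R) (i : σ) (m : ℕ) :
    monomialValue z (Finsupp.single i m) = z i ^ m := by
  classical
  rw [monomialValue, Finset.prod_eq_single i]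
  · rw [Finsupp.single_eq_same]
  · intro j _ hj
    rw [Finsupp.single_eq_of_ne hj, pow_zero]
  · exact fun h => absurd (Finset.mem_univ i) h

theorem univariate_mem_convergentSeries (i : σ) {g : ℕ → ℕ} {b : ℕ} (hg : ∀ n, g n < b) :
    univariate i g ∈ convergentSeries σ := by
  rw [mem_convergentSeries, ← (Finsupp.single_injective i).summable_iff]
  · refine Summable.of_nonneg_of_le (fun m => halfTerm_nonneg _ _) (fun m => ?_)
      (summable_geometric_two.mul_left (b : ℝ))
    rw [Function.comp_apply, halfTerm, coeff_univariate_single, monomialValue_single]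
    refine mul_le_mul_of_nonneg_right ?_ (by positivity)
    rw [Rat.cast_natCast, Nat.abs_cast]
    exact_mod_cast (hg m).le
  · intro μ hμ
    rw [halfTerm, coeff_univariate_of_notMem i g hμ, Rat.cast_zero, abs_zero, zero_mul]

theorem evalSeries_univariate {z : σ → ℝ} (hz : ∀ i, 0 ≤ z i) (hz' : ∀ i, z i ≤ 1 / 2) (i : σ)
    {g : ℕ → ℕ} {b : ℕ} (hg : ∀ n, g n < b) :
    evalSeries z hz hz' ⟨_, univariate_mem_convergentSeries i hg⟩ = ∑' m, (g m : ℝ) * z i ^ m := by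
  rw [evalSeries_apply, ← (Finsupp.single_injective i).tsum_eq]
  · refine tsum_congr fun m => ?_
    rw [seriesTerm, coeff_univariate_single, monomialValue_single, Rat.cast_natCast]
  · intro μ hμ
    by_contra h
    refine hμ ?_
    change seriesTerm _ _ _ = 0
    rw [seriesTerm, coeff_univariate_of_notMem i g h, Rat.cast_zero, zero_mul]

theorem univariate_mem_seriesIn (i : σ) {g : ℕ → ℕ} {b : ℕ} (hg : ∀ n, g n < b) :
    (⟨_, univariate_mem_convergentSeries i hg⟩ : convergentSeries σ) ∈ seriesIn ({i} : Set σ) := by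
  intro μ hμ j hj
  by_contra hj0
  refine hμ (coeff_univariate_of_notMem i g ?_)
  rintro ⟨m, rfl⟩
  exact hj0 (Finsupp.single_eq_of_ne hj)

theorem univariate_mem_finiteValued {g : ℕ → ℕ} {b : ℕ} (hg : ∀ n, g n < b) :
    (⟨_, univariate_mem_convergentSeries () hg⟩ : convergentSeries Unit) ∈ finiteValued := by
  refine ((Set.finite_lt_nat b).image (fun n : ℕ => (n : ℚ))).subset ?_
  rintro _ ⟨n, rfl⟩
  refine ⟨g n, hg n, ?_⟩
  exact (coeff_univariate_single () g n).symm

theorem one_mem_finiteValued : (1 : convergentSeries Unit) ∈ finiteValued := by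
  refine (Set.toFinite ({0, 1} : Set ℚ)).subset ?_
  rintro _ ⟨n, rfl⟩
  change PowerSeries.coeff n (1 : PowerSeries ℚ) ∈ _
  rw [PowerSeries.coeff_one]
  split_ifs <;> simp

end BoundedSeries

section AutomaticDecomposition

theorem summable_digits {b : ℕ} {a : ℕ → ℕ} (ha : ∀ n, a n < b) {z : ℝ} (hz : 0 ≤ z)
    (hz1 : z < 1) : Summable fun n => (a n : ℝ) * z ^ n := by
  refine Summable.of_nonneg_of_le (fun n => by positivity) (fun n => ?_)
    ((summable_geometric_of_lt_one hz hz1).mul_left (b : ℝ))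
  exact mul_le_mul_of_nonneg_right (by exact_mod_cast (ha n).le) (by positivity)

open Classical in
/-- The weight of the subsequence `g` in the decomposition of a base-`b` expansion `a` into
its subsequences along residue classes modulo `L`. -/
def residueWeight (b L : ℕ) [NeZero L] (a g : ℕ → ℕ) : ℕ :=
  ∑ j : ZMod L, if (fun m => a (L * m + j.val)) = g then b ^ (L - j.val) else 0

theorem residueWeight_le {b : ℕ} (hb : 2 ≤ b) (L : ℕ) [NeZero L] (a g : ℕ → ℕ) :
    residueWeight b L a g ≤ (b ^ L) ^ 2 := by
  classical
  calc residueWeight b L a g ≤ ∑ _j : ZMod L, b ^ L := by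
        refine Finset.sum_le_sum fun j _ => ?_
        split_ifs
        · exact Nat.pow_le_pow_right (by omega) (Nat.sub_le _ _)
        · exact Nat.zero_le _
    _ = L * b ^ L := by rw [Finset.sum_const, Finset.card_univ, ZMod.card, smul_eq_mul]
    _ ≤ (b ^ L) ^ 2 := by
        rw [pow_two]
        exact Nat.mul_le_mul_right _
          (Nat.lt_two_pow_self.le.trans (Nat.pow_le_pow_left hb L))

theorem tsum_digits_eq {b : ℕ} (hb : 2 ≤ b) {a : ℕ → ℕ} (ha : ∀ n, a n < b) (L : ℕ) [NeZero L]
    {K : Finset (ℕ → ℕ)} (hK : ∀ j < L, (fun m => a (L * m + j)) ∈ K) :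
    ∑' n, (a n : ℝ) * (b : ℝ)⁻¹ ^ n =
      ∑ g ∈ K, (residueWeight b L a g : ℝ) / (b : ℝ) ^ L *
        ∑' m, (g m : ℝ) * (((b ^ L : ℕ) : ℝ)⁻¹) ^ m := by
  classical
  have hb0 : (b : ℝ) ≠ 0 := by positivity
  rw [Nat.sumByResidueClasses (summable_digits ha (by positivity)
    (inv_lt_one_of_one_lt₀ (by exact_mod_cast hb))) L]
  simp_rw [residueWeight, Nat.cast_sum, Finset.sum_div, Finset.sum_mul]
  rw [Finset.sum_comm]
  refine Finset.sum_congr rfl fun j _ => ?_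
  rw [Finset.sum_eq_single_of_mem _ (hK j.val j.val_lt), if_pos rfl, ← tsum_mul_left]
  · refine tsum_congr fun m => ?_
    rw [add_comm j.val, pow_add, pow_mul, Nat.cast_pow, Nat.cast_pow, inv_pow (b : ℝ) L,
      pow_sub₀ _ hb0 j.val_lt.le, inv_pow (b : ℝ) j.val]
    field_simp
  · intro g _ hg
    rw [if_neg hg.symm, Nat.cast_zero, zero_div, zero_mul]

namespace Scales

open Filter

variable {σ : Type*} [Fintype σ] (T : Scales σ)

theorem coe_natCast_mem_boundedRationals (i : σ) {w : ℕ → ℕ} (C : ℕ)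
    (hw : ∀ n, w n ≤ T.B n i ^ C) :
    ((fun n => (w n : ℝ) : ℕ → ℝ) : T.Field) ∈ T.setup.boundedRationals := by
  refine T.setup.mem_boundedRationals.2 ⟨_, 1, ⟨⟨fun n => w n, by simp⟩, ?_⟩,
    ⟨one_mem _, one_mem _⟩, one_ne_zero, (div_one _).symm⟩
  refine T.setup.mem_polyBounded_of_le (pow_mem (T.setup.B_mem_polyBounded i) C) ?_
  change |((fun n => (w n : ℝ) : ℕ → ℝ) : T.Field)| ≤
    |((fun n => (T.B n i : ℝ) : ℕ → ℝ) : T.Field) ^ C|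
  rw [← Germ.coe_pow, abs_coe_eq, abs_coe_eq, Germ.coe_le]
  refine Eventually.of_forall fun n => ?_
  simp only [Pi.pow_apply, ← Nat.cast_pow, Nat.abs_cast]
  exact_mod_cast hw n

theorem const_mem_span_of_automaticInBase {i : σ} {b : ℕ} (hb : 2 ≤ b) {k : ℕ} (hk : 2 ≤ k)
    {l : ℕ → ℕ} (hB : ∀ n, T.B n i = b ^ k ^ l n) {a : ℕ → ℕ} (ha : ∀ n, a n < b)
    (hauto : IsKAutomatic k a) {ξ : ℝ}
    (hξ : Int.fract ξ = ∑' n : ℕ, (a (n + 1) : ℝ) / (b : ℝ) ^ (n + 1))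
    {A : Set (convergentSeries σ)} (h1 : 1 ∈ A)
    (hA : ∀ (g : ℕ → ℕ) (hg : ∀ n, g n < b), ⟨_, univariate_mem_convergentSeries i hg⟩ ∈ A) :
    T.const ξ ∈ Submodule.span T.setup.boundedRationals (T.setup.ev '' A) := by
  set V := Submodule.span T.setup.boundedRationals (T.setup.ev '' A) with hV
  have hmul : ∀ w ∈ T.setup.boundedRationals, ∀ c ∈ A, w * T.setup.ev c ∈ V := fun w hw c hc =>
    V.smul_mem ⟨w, hw⟩ (Submodule.subset_span ⟨c, hc, rfl⟩)
  have hH : ∀ w ∈ T.setup.boundedRationals, w ∈ V := fun w hw => by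
    simpa using hmul w hw 1 h1
  have hsum : Summable fun n => (a n : ℝ) * (b : ℝ)⁻¹ ^ n :=
    summable_digits ha (by positivity) (inv_lt_one_of_one_lt₀ (by exact_mod_cast hb))
  have hξ' : ξ = ∑' n, (a n : ℝ) * (b : ℝ)⁻¹ ^ n - a 0 + ⌊ξ⌋ := by
    simp_rw [div_eq_mul_inv, ← inv_pow] at hξ
    rw [hsum.tsum_eq_zero_add, pow_zero, mul_one, add_sub_cancel_left, ← hξ, Int.fract_add_floor]
  have hint : ∀ m : ℤ, T.const m ∈ T.setup.boundedRationals := fun m => by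
    rw [map_intCast]
    exact intCast_mem _ m
  suffices h : T.const (∑' n, (a n : ℝ) * (b : ℝ)⁻¹ ^ n) ∈ V by
    rw [hξ', map_add, map_sub]
    exact add_mem (sub_mem h (hH _ (by exact_mod_cast hint (a 0)))) (hH _ (hint _))
  let K := hauto.toFinset
  have hkl : ∀ n, NeZero (k ^ l n) := fun n => ⟨(pow_pos (by omega) _).ne'⟩
  have hgb : ∀ g ∈ K, ∀ n, g n < b := by
    intro g hg n
    obtain ⟨e, j, -, rfl⟩ := hauto.mem_toFinset.1 hg
    exact ha _
  let w : (ℕ → ℕ) → ℕ → ℝ := fun g n =>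
    (residueWeight b (k ^ l n) a g : ℝ) / (b : ℝ) ^ k ^ l n
  have hw : ∀ g, (w g : T.Field) ∈ T.setup.boundedRationals := by
    intro g
    have h := div_mem (T.coe_natCast_mem_boundedRationals i
        (w := fun n => residueWeight b (k ^ l n) a g) 2 fun n => by
          rw [hB]; exact residueWeight_le hb _ a g)
      (T.coe_natCast_mem_boundedRationals i (w := fun n => T.B n i) 1 fun n => (pow_one _).ge)
    convert h using 1
    rw [← Germ.coe_div]
    refine congrArg Germ.ofFun (funext fun n => ?_)
    simp [w, hB]
  have hdec : T.const (∑' n, (a n : ℝ) * (b : ℝ)⁻¹ ^ n) =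
      ∑ g ∈ K.attach, (w g : T.Field) *
        T.setup.ev ⟨_, univariate_mem_convergentSeries i (hgb g g.2)⟩ := by
    have : (fun _ => ∑' n, (a n : ℝ) * (b : ℝ)⁻¹ ^ n : ℕ → ℝ) =
        ∑ g ∈ K.attach, w g *
          fun n => T.evalAt n ⟨_, univariate_mem_convergentSeries i (hgb g g.2)⟩ := by
      ext n
      rw [tsum_digits_eq hb ha (k ^ l n) (K := K)
        fun j hj => hauto.mem_toFinset.2 ⟨l n, j, hj, rfl⟩, Finset.sum_apply, ← Finset.sum_attach]
      refine Finset.sum_congr rfl fun g _ => ?_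
      rw [Pi.mul_apply, evalAt, evalSeries_univariate _ _ i (hgb g g.2), z, hB]
    rw [const_apply, this]
    change Germ.coeRingHom _ _ = _
    rw [map_sum]
    exact Finset.sum_congr rfl fun g _ => map_mul (Germ.coeRingHom _) _ _
  rw [hdec]
  exact sum_mem fun g _ => hmul _ (hw g) _ (hA g (hgb g g.2))

end Scales

end AutomaticDecomposition

section Construction

open Filter Topology

variable {σ : Type*} [Fintype σ]

theorem sum_mul_log_ne_zero {b : σ → ℕ} (hb : ∀ i, 2 ≤ b i)
    (hind : ∀ μ : σ → ℤ, (∏ i, (b i : ℝ) ^ μ i) = 1 → μ = 0) {μ ν : σ →₀ ℕ} (hμν : μ ≠ ν) :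
    ∑ i, ((μ i : ℝ) - ν i) * Real.log (b i) ≠ 0 := by
  intro h
  have hb0 : ∀ i, 0 < (b i : ℝ) := fun i => Nat.cast_pos.2 (by have := hb i; omega)
  have h1 : ∏ i, (b i : ℝ) ^ ((μ i : ℤ) - ν i) = 1 := by
    refine Real.eq_one_of_pos_of_log_eq_zero (Finset.prod_pos fun i _ => zpow_pos (hb0 i) _) ?_
    rw [Real.log_prod fun i _ => (zpow_pos (hb0 i) _).ne', ← h]
    refine Finset.sum_congr rfl fun i _ => ?_
    rw [Real.log_zpow]
    push_cast
    rfl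
  refine hμν (Finsupp.ext fun i => ?_)
  have := congrFun (hind _ h1) i
  simp only [Pi.zero_apply] at this
  omega

theorem tendsto_monomialValue_div {l : Filter ℕ} {b : σ → ℕ} (hb : ∀ i, 2 ≤ b i) {e : ℕ → σ → ℕ}
    {t : ℕ → ℝ} (ht : Tendsto t l atTop)
    (he : ∀ i, Tendsto (fun n => (e n i : ℝ) / t n) l (𝓝 1)) {μ ν : σ →₀ ℕ}
    (hμν : 0 < ∑ i, ((μ i : ℝ) - ν i) * Real.log (b i)) :
    Tendsto (fun n => monomialValue (fun i => ((b i ^ e n i : ℕ) : ℝ)⁻¹) μ /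
      monomialValue (fun i => ((b i ^ e n i : ℕ) : ℝ)⁻¹) ν) l (𝓝 0) := by
  have hb0 : ∀ i, 0 < (b i : ℝ) := fun i => Nat.cast_pos.2 (by have := hb i; omega)
  have hval : ∀ n (ρ : σ →₀ ℕ), monomialValue (fun i => ((b i ^ e n i : ℕ) : ℝ)⁻¹) ρ =
      Real.exp (-∑ i, (ρ i : ℝ) * (e n i * Real.log (b i))) := by
    intro n ρ
    rw [monomialValue, Real.exp_neg, Real.exp_sum, ← Finset.prod_inv_distrib]
    refine Finset.prod_congr rfl fun i _ => ?_
    rw [inv_pow, Real.exp_nat_mul, Real.exp_nat_mul, Real.exp_log (hb0 i), Nat.cast_pow]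
  have hlim : Tendsto (fun n => ∑ i, ((μ i : ℝ) - ν i) * ((e n i : ℝ) / t n * Real.log (b i))) l
      (𝓝 (∑ i, ((μ i : ℝ) - ν i) * (1 * Real.log (b i)))) :=
    tendsto_finsetSum _ fun i _ => ((he i).mul_const _).const_mul _
  simp only [one_mul] at hlim
  have h1 := Real.tendsto_exp_neg_atTop_nhds_zero.comp (ht.atTop_mul_pos hμν hlim)
  refine h1.congr' ?_
  filter_upwards [ht.eventually_gt_atTop 0] with n hn
  rw [hval, hval, ← Real.exp_sub, Function.comp_apply, Finset.mul_sum, neg_sub_neg,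
    ← Finset.sum_sub_distrib, ← Finset.sum_neg_distrib]
  refine congrArg Real.exp (Finset.sum_congr rfl fun i _ => ?_)
  field_simp
  ring

theorem comparable_monomialValue {l : Filter ℕ} {b : σ → ℕ} (hb : ∀ i, 2 ≤ b i)
    (hind : ∀ μ : σ → ℤ, (∏ i, (b i : ℝ) ^ μ i) = 1 → μ = 0) {e : ℕ → σ → ℕ}
    {t : ℕ → ℝ} (ht : Tendsto t l atTop)
    (he : ∀ i, Tendsto (fun n => (e n i : ℝ) / t n) l (𝓝 1)) {μ ν : σ →₀ ℕ} (hμν : μ ≠ ν) :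
    Tendsto (fun n => monomialValue (fun i => ((b i ^ e n i : ℕ) : ℝ)⁻¹) μ /
      monomialValue (fun i => ((b i ^ e n i : ℕ) : ℝ)⁻¹) ν) l (𝓝 0) ∨
    Tendsto (fun n => monomialValue (fun i => ((b i ^ e n i : ℕ) : ℝ)⁻¹) ν /
      monomialValue (fun i => ((b i ^ e n i : ℕ) : ℝ)⁻¹) μ) l (𝓝 0) := by
  rcases (sum_mul_log_ne_zero hb hind hμν).lt_or_gt with h | h
  · refine Or.inr (tendsto_monomialValue_div hb ht he ?_)
    rw [← neg_pos, ← Finset.sum_neg_distrib] at h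
    refine h.trans_eq (Finset.sum_congr rfl fun i _ => ?_)
    ring
  · exact Or.inl (tendsto_monomialValue_div hb ht he h)

/-- The scales `b ^ k ^ n` for a single variable. -/
def singleScale {b k : ℕ} (hb : 2 ≤ b) (hk : 2 ≤ k) : Scales Unit where
  U := hyperfilter ℕ
  B n _ := b ^ k ^ n
  two_le_B n _ := hb.trans (Nat.le_self_pow (pow_pos (by omega) n).ne' b)
  β n := (b ^ k ^ n : ℕ)
  tendsto_β := by
    refine tendsto_natCast_atTop_atTop.comp ?_
    exact ((tendsto_pow_atTop_atTop_of_one_lt hb).comp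
      (tendsto_pow_atTop_atTop_of_one_lt hk)).mono_left Nat.hyperfilter_le_atTop
  κ := 1
  le_B _ := Eventually.of_forall fun _ => le_rfl
  B_le _ := Eventually.of_forall fun _ => (pow_one _).ge
  comparable μ ν hμν := by
    refine comparable_monomialValue (b := fun _ => b) (e := fun n _ => k ^ n)
      (t := fun n => ((k ^ n : ℕ) : ℝ)) (fun _ => hb) (fun d hd => ?_) ?_ (fun _ => ?_) hμν
    · rw [Finset.univ_unique, Finset.prod_singleton] at hd
      ext
      exact (zpow_eq_one_iff_right₀ (by positivity) (by exact_mod_cast (by omega : b ≠ 1))).1 hd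
    · exact tendsto_natCast_atTop_atTop.comp
        ((tendsto_pow_atTop_atTop_of_one_lt hk).mono_left Nat.hyperfilter_le_atTop)
    · refine tendsto_const_nhds.congr fun n => (div_self ?_).symm
      exact_mod_cast (pow_pos (by omega) n).ne'

theorem exists_scales (U : Ultrafilter ℕ) {b : σ → ℕ} (hb : ∀ i, 2 ≤ b i)
    (hind : ∀ μ : σ → ℤ, (∏ i, (b i : ℝ) ^ μ i) = 1 → μ = 0) {e : ℕ → σ → ℕ}
    (he0 : ∀ n i, e n i ≠ 0) {t : ℕ → ℝ} (ht : Tendsto t U atTop)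
    (he : ∀ i, Tendsto (fun n => (e n i : ℝ) / t n) U (𝓝 1)) :
    ∃ T : Scales σ, ∀ n i, T.B n i = b i ^ e n i := by
  have hb0 : ∀ i, 0 < (b i : ℝ) := fun i => Nat.cast_pos.2 (by have := hb i; omega)
  have hlog : ∀ i, Real.log 2 ≤ Real.log (b i) := fun i =>
    Real.log_le_log two_pos (by exact_mod_cast hb i)
  have hlog2 : 0 < Real.log 2 := Real.log_pos one_lt_two
  have hexp : ∀ n i, ((b i ^ e n i : ℕ) : ℝ) = Real.exp (e n i * Real.log (b i)) := fun n i => by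
    rw [Real.exp_nat_mul, Real.exp_log (hb0 i), Nat.cast_pow]
  set c := Real.log 2 / 2 with hc
  have hc0 : 0 < c := by positivity
  obtain ⟨κ, hκ⟩ := exists_nat_ge (2 * (∑ i, Real.log (b i)) / c)
  refine ⟨{ U := U, B := fun n i => b i ^ e n i, two_le_B := fun n i => ?_,
            β := fun n => Real.exp (t n * c), tendsto_β := ?_, κ := κ, le_B := fun i => ?_,
            B_le := fun i => ?_,
            comparable := fun μ ν hμν => comparable_monomialValue hb hind ht he hμν },
    fun n i => rfl⟩
  · exact (hb i).trans (Nat.le_self_pow (he0 n i) _)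
  · exact Real.tendsto_exp_atTop.comp (ht.atTop_mul_const hc0)
  · filter_upwards [ht.eventually_gt_atTop 0, (he i).eventually_const_le one_half_lt_one]
      with n hn h
    rw [le_div_iff₀ hn] at h
    rw [hexp, Real.exp_le_exp]
    nlinarith [mul_le_mul h (hlog i) hlog2.le (Nat.cast_nonneg _)]
  · filter_upwards [ht.eventually_gt_atTop 0, (he i).eventually_le_const one_lt_two] with n hn h
    rw [div_le_iff₀ hn] at h
    rw [hexp, ← Real.exp_nat_mul, Real.exp_le_exp]
    have h1 : Real.log (b i) ≤ ∑ i, Real.log (b i) :=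
      Finset.single_le_sum (fun j _ => hlog2.le.trans (hlog j)) (Finset.mem_univ i)
    rw [div_le_iff₀ hc0] at hκ
    calc (e n i : ℝ) * Real.log (b i) ≤ 2 * t n * Real.log (b i) :=
          mul_le_mul_of_nonneg_right h (hlog2.le.trans (hlog i))
      _ = t n * (2 * Real.log (b i)) := by ring
      _ ≤ t n * (κ * c) := mul_le_mul_of_nonneg_left (by linarith) hn.le
      _ = κ * (t n * c) := by ring

/-- Powers of several integers can simultaneously be asymptotic to powers of two. -/
theorem exists_tendsto_pow_div_two_pow {ι : Type*} {k : ι → ℕ} (hk : ∀ i, 2 ≤ k i) :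
    ∃ (U : Ultrafilter ℕ) (l : ℕ → ι → ℕ), (U : Filter ℕ) ≤ atTop ∧
      ∀ i, Tendsto (fun n => ((k i ^ l n i : ℕ) : ℝ) / 2 ^ n) U (𝓝 1) := by
  have hlog2 : 0 < Real.log 2 := Real.log_pos one_lt_two
  have hlog : ∀ i, 0 < Real.log (k i) := fun i => Real.log_pos (by exact_mod_cast hk i)
  let x : ι → ℝ := fun i => Real.log 2 / Real.log (k i)
  obtain ⟨U, hU, hlim⟩ := mapClusterPt_iff_ultrafilter.1
    (mapClusterPt_zero_atTop_nsmul (fun i => (x i : UnitAddCircle)))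
  refine ⟨U, fun n i => (round (n * x i)).toNat, hU, fun i => ?_⟩
  have h0 : ∀ n : ℕ, 0 ≤ n * x i := fun n =>
    mul_nonneg n.cast_nonneg (div_nonneg hlog2.le (hlog i).le)
  have hround : ∀ n : ℕ, (((round (n * x i)).toNat : ℕ) : ℝ) = round (n * x i) := fun n => by
    have : 0 ≤ round (n * x i) := by
      rw [round_eq]
      exact Int.floor_nonneg.2 (by linarith [h0 n])
    exact_mod_cast Int.toNat_of_nonneg this
  have h1 : Tendsto (fun n : ℕ => n * x i - round (n * x i)) U (𝓝 0) := by
    rw [tendsto_zero_iff_abs_tendsto_zero]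
    have := (tendsto_pi_nhds.1 hlim i).norm
    rw [Pi.zero_apply, norm_zero] at this
    refine this.congr fun n => ?_
    rw [Function.comp_apply, ← UnitAddCircle.norm_eq]
    simp
  have h2 : Tendsto (fun n : ℕ => Real.exp (-(n * x i - round (n * x i)) * Real.log (k i))) U
      (𝓝 1) := by
    have := (Real.continuous_exp.tendsto _).comp (h1.neg.mul_const (Real.log (k i)))
    simpa [Function.comp_def] using this
  refine h2.congr fun n => ?_
  have hk0 : 0 < (k i : ℝ) := Nat.cast_pos.2 (by have := hk i; omega)
  have h3 : ((k i ^ (round (n * x i)).toNat : ℕ) : ℝ) =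
      Real.exp (round (n * x i) * Real.log (k i)) := by
    rw [← hround, Real.exp_nat_mul, Real.exp_log hk0, Nat.cast_pow]
  have h4 : (2 : ℝ) ^ n = Real.exp (n * Real.log 2) := by
    rw [Real.exp_nat_mul, Real.exp_log two_pos]
  rw [h3, h4, ← Real.exp_sub]
  refine congrArg Real.exp ?_
  have : x i * Real.log (k i) = Real.log 2 := div_mul_cancel₀ _ (hlog i).ne'
  rw [← this]
  ring

end Construction

theorem AutomaticInBase.transcendental {b : ℕ} (hb : 2 ≤ b) {ξ : ℝ} (hξ : AutomaticInBase b ξ)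
    (hirr : ¬ ∃ p : ℚ, ξ = p) : Transcendental ℚ ξ := by
  obtain ⟨k, hk, a, ha, hauto, hsum⟩ := hξ
  intro halg
  let T := singleScale hb hk
  have hspan : T.const ξ ∈ Submodule.span T.setup.boundedRationals (T.setup.ev '' finiteValued) :=
    T.const_mem_span_of_automaticInBase (i := ()) hb hk (l := id) (fun _ => rfl) ha hauto hsum
      one_mem_finiteValued fun _ hg => univariate_mem_finiteValued hg
  refine hirr (T.exists_rat_of_const_mem_boundedRationals
    (T.setup.mem_boundedRationals_of_isAlgebraic rfl hspan ?_))
  exact (isAlgebraic_algHom_iff T.const.toRatAlgHom T.const.injective).2 halg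

theorem algebraicIndependent_of_transcendental {σ : Type*} [Fintype σ] {b : σ → ℕ}
    (hb : ∀ i, 2 ≤ b i) (hind : ∀ μ : σ → ℤ, (∏ i, (b i : ℝ) ^ μ i) = 1 → μ = 0) {ξ : σ → ℝ}
    (hξ : ∀ i, AutomaticInBase (b i) (ξ i)) (htr : ∀ i, Transcendental ℚ (ξ i)) :
    AlgebraicIndependent ℚ ξ := by
  choose k hk a ha hauto hsum using hξ
  obtain ⟨U, l, hU, hl⟩ := exists_tendsto_pow_div_two_pow hk
  obtain ⟨T, hT⟩ := exists_scales U hb hind (e := fun n i => k i ^ l n i)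
    (fun n i => (pow_pos (by have := hk i; omega) _).ne')
    ((tendsto_pow_atTop_atTop_of_one_lt one_lt_two).mono_left hU) hl
  refine (T.const.toRatAlgHom.algebraicIndependent_iff T.const.injective).1
    (T.setup.algebraicIndependent_mixedValues (fun i => ?_)
      fun i h => htr i (T.isAlgebraic_of_const_mem_acl h))
  exact T.const_mem_span_of_automaticInBase (hb i) (hk i) (l := fun n => l n i) (fun n => hT n i)
    (ha i) (hauto i) (hsum i) (one_mem _) fun _ hg => univariate_mem_seriesIn i hg

/-- **Adamczewski–Faverjon, Conjecture A.2 (now a theorem).**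
Let `b_1, …, b_r` be multiplicatively independent integers `≥ 2` and, for each `i`, let `ξ_i`
be a real number automatic in base `b_i`.  Then `ξ_1, …, ξ_r` are algebraically independent
over `ℚ̄`, unless one of them is rational.  (In particular, an irrational real number cannot
be automatic in two multiplicatively independent integer bases.) -/
theorem automatic_numbers_algebraically_independent
    (r : ℕ) (hr : 1 ≤ r)
    (b : Fin r → ℕ) (hb : ∀ i, 2 ≤ b i)
    (hbindep : ∀ μ : Fin r → ℤ, (∏ i, (b i : ℝ) ^ μ i) = 1 → μ = 0)
    (ξ : Fin r → ℝ)
    (hξ : ∀ i, AutomaticInBase (b i) (ξ i)) :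
    (∃ i, ∃ p : ℚ, ξ i = (p : ℝ)) ∨
      AlgebraicIndependent (integralClosure ℚ ℂ) (fun i => ((ξ i : ℂ) : ℂ)) := by
  by_cases hrat : ∃ i, ∃ p : ℚ, ξ i = (p : ℝ)
  · exact Or.inl hrat
  right
  have h : AlgebraicIndependent ℚ ξ :=
    algebraicIndependent_of_transcendental hb hbindep hξ fun i =>
      (hξ i).transcendental (hb i) fun h => hrat ⟨i, h⟩
  exact (h.map' (f := Complex.ofRealHom.toRatAlgHom) Complex.ofReal_injective).integralClosure
end
end
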